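/- arXiv:2305.10074 — 4 statements merged into one kernel-verified Lean document; each statement's English description precedes it below -/
import Mathlib

section
/- Let Σ_∅, Σ_1, Σ_2, Σ_{12} > 0 and let M be the 3×4 real matrix with rows (Σ_∅Σ_1, Σ_∅Σ_2, 0, 0), (0, Σ_{12}/Σ_∅, 1, 0), (0, −Σ_{12}Σ_2/(Σ_∅Σ_1), 0, 1). Then: (i) every 3 cyclically consecutive columns of M are linearly independent; (ii) with t = (Σ_{12}/Σ_2, Σ_2/Σ_∅, Σ_∅/Σ_1, Σ_1/Σ_{12}), the matrix t·τ⃗(M) equals [[Σ_{12}/(Σ_∅Σ_1Σ_2), 1/Σ_∅², 0, 0], [0, 0, Σ_∅/Σ_1, Σ_2/Σ_{12}], [Σ_∅/Σ_2, 0, 0, Σ_1/Σ_{12}]] as an equality of matrices; (iii) the 3×3 minors of t·τ⃗(M) are Δ_{123} = Δ_{134} = 1/(Σ_1Σ_2) and Δ_{124} = Δ_{234} = 1/(Σ_∅Σ_{12}); (iv) the rows of t·τ⃗(M) are pairwise Ω-orthogonal, where Ω is the form on ℝ^4 with n = 2. -/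
open Matrix

/-- The `i`-th column of a `k × N` real matrix, with columns extended cyclically to all
integer indices (`M_{i+N} := M_i`). For `N = 0` we return the zero vector. -/
noncomputable def colZ {k N : ℕ} (M : Matrix (Fin k) (Fin N) ℝ) (i : ℤ) : Fin k → ℝ :=
  fun r =>
    if h : 0 < N then
      M r ⟨(i % (N : ℤ)).toNat, by
        have hN : (0 : ℤ) < (N : ℤ) := by exact_mod_cast h
        have h1 := Int.emod_nonneg i (ne_of_gt hN)
        have h2 := Int.emod_lt_of_pos i hN
        omega⟩
    else 0

/-- `T` is the right twist `τ⃗(M)`: its `i`-th column pairs to `1` with `M_i` and to `0`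
with `M_j` for `i < j ≤ i + k − 1`. -/
def IsRightTwist {k N : ℕ} (M T : Matrix (Fin k) (Fin N) ℝ) : Prop :=
  ∀ i : ℤ,
    colZ T i ⬝ᵥ colZ M i = 1 ∧
    ∀ j : ℤ, i < j → j ≤ i + (k : ℤ) - 1 → colZ T i ⬝ᵥ colZ M j = 0

/-- The skew-symmetric bilinear form `Ω` on `ℝ^{2n}` (one-based indices in the formula,
rendered zero-based). -/
noncomputable def Omega (n : ℕ) (x y : Fin (2 * n) → ℝ) : ℝ :=
  if h : 0 < n then
    (∑ i : Fin n,
      (x ⟨2 * i, by have := i.isLt; omega⟩ * y ⟨2 * i + 1, by have := i.isLt; omega⟩ -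
        x ⟨2 * i + 1, by have := i.isLt; omega⟩ * y ⟨2 * i, by have := i.isLt; omega⟩)) +
    (∑ j : Fin (n - 1),
      (x ⟨2 * j + 2, by have := j.isLt; omega⟩ * y ⟨2 * j + 1, by have := j.isLt; omega⟩ -
        x ⟨2 * j + 1, by have := j.isLt; omega⟩ * y ⟨2 * j + 2, by have := j.isLt; omega⟩)) +
    (-1 : ℝ) ^ n *
      (x ⟨0, by omega⟩ * y ⟨2 * n - 1, by omega⟩ - x ⟨2 * n - 1, by omega⟩ * y ⟨0, by omega⟩)
  else 0

/-- The `3×3` minor of a `3 × 4` matrix on columns `i, j, k`. -/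
def minor3 (M : Matrix (Fin 3) (Fin 4) ℝ) (i j k : Fin 4) : ℝ :=
  Matrix.det !![M 0 i, M 0 j, M 0 k; M 1 i, M 1 j, M 1 k; M 2 i, M 2 j, M 2 k]

theorem colZ_eq_aux (M : Matrix (Fin 3) (Fin 4) ℝ) (i : ℤ) (c : Fin 4)
    (h : i % 4 = ((c : ℕ) : ℤ)) : colZ M i = fun r => M r c := by
  funext r
  unfold colZ
  rw [dif_pos (by norm_num)]
  congr 1
  apply Fin.ext
  show (i % ((4 : ℕ) : ℤ)).toNat = (c : ℕ)
  have : ((4 : ℕ) : ℤ) = 4 := rfl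
  rw [this, h]
  simp

theorem mod_cases_aux (i : ℤ) : ∃ c : Fin 4, i % 4 = ((c : ℕ) : ℤ) ∧
    (i + 1) % 4 = (((c + 1 : Fin 4) : ℕ) : ℤ) ∧ (i + 2) % 4 = (((c + 2 : Fin 4) : ℕ) : ℤ) := by
  have : i % 4 = 0 ∨ i % 4 = 1 ∨ i % 4 = 2 ∨ i % 4 = 3 := by omega
  rcases this with h | h | h | h
  · exact ⟨0, by simpa using h, by simp; omega, by simp; omega⟩
  · exact ⟨1, by simpa using h, by simp; omega, by simp; omega⟩
  · exact ⟨2, by simpa using h, by simp; omega, by simp; omega⟩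
  · exact ⟨3, by simpa using h, by simp; omega, by simp; omega⟩

theorem twist_iff_aux (M T : Matrix (Fin 3) (Fin 4) ℝ) : IsRightTwist M T ↔
    ∀ c : Fin 4, (T 0 c * M 0 c + T 1 c * M 1 c + T 2 c * M 2 c = 1) ∧
      (T 0 c * M 0 (c+1) + T 1 c * M 1 (c+1) + T 2 c * M 2 (c+1) = 0) ∧
      (T 0 c * M 0 (c+2) + T 1 c * M 1 (c+2) + T 2 c * M 2 (c+2) = 0) := by
  constructor
  · intro h c
    obtain ⟨a, b⟩ := h ((c : ℕ) : ℤ)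
    have b1 := b (((c : ℕ) : ℤ) + 1) (by omega) (by push_cast; omega)
    have b2 := b (((c : ℕ) : ℤ) + 2) (by omega) (by push_cast; omega)
    have e0 : ((c : ℕ) : ℤ) % 4 = ((c : ℕ) : ℤ) := by omega
    have e1 : (((c : ℕ) : ℤ) + 1) % 4 = (((c + 1 : Fin 4) : ℕ) : ℤ) := by
      fin_cases c <;> rfl
    have e2 : (((c : ℕ) : ℤ) + 2) % 4 = (((c + 2 : Fin 4) : ℕ) : ℤ) := by
      fin_cases c <;> rfl
    rw [colZ_eq_aux _ _ _ e0, colZ_eq_aux _ _ _ e0] at a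
    rw [colZ_eq_aux _ _ _ e0, colZ_eq_aux _ _ _ e1] at b1
    rw [colZ_eq_aux _ _ _ e0, colZ_eq_aux _ _ _ e2] at b2
    simp only [dotProduct, Fin.sum_univ_three] at a b1 b2
    exact ⟨a, b1, b2⟩
  · intro h i
    obtain ⟨c, e0, e1, e2⟩ := mod_cases_aux i
    obtain ⟨a, b1, b2⟩ := h c
    refine ⟨?_, fun j hj hj' => ?_⟩
    · rw [colZ_eq_aux _ _ _ e0, colZ_eq_aux _ _ _ e0]
      simpa only [dotProduct, Fin.sum_univ_three] using a
    · have : j = i + 1 ∨ j = i + 2 := by push_cast at hj'; omega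
      rcases this with rfl | rfl
      · rw [colZ_eq_aux _ _ _ e0, colZ_eq_aux _ _ _ e1]
        simpa only [dotProduct, Fin.sum_univ_three] using b1
      · rw [colZ_eq_aux _ _ _ e0, colZ_eq_aux _ _ _ e2]
        simpa only [dotProduct, Fin.sum_univ_three] using b2

theorem linInd_aux (M : Matrix (Fin 3) (Fin 4) ℝ)
    (h : ∀ c : Fin 4, minor3 M c (c+1) (c+2) ≠ 0) (i : ℤ) :
    LinearIndependent ℝ (fun j : Fin 3 => colZ M (i + (j : ℤ))) := by
  obtain ⟨c, e0, e1, e2⟩ := mod_cases_aux i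
  have hc := h c
  unfold minor3 at hc
  have := Matrix.linearIndependent_cols_of_det_ne_zero hc
  refine Eq.subst (motive := fun f => LinearIndependent ℝ f) (Eq.symm ?_) this
  funext j
  fin_cases j
  · have := colZ_eq_aux M (i + 0) c (by simpa using e0)
    refine Eq.trans this ?_
    funext r; fin_cases r <;> rfl
  · refine Eq.trans (colZ_eq_aux M _ _ e1) ?_
    funext r; fin_cases r <;> rfl
  · refine Eq.trans (colZ_eq_aux M _ _ e2) ?_
    funext r; fin_cases r <;> rfl

theorem right_twist_example (S0 S1 S2 S12 : ℝ) (h0 : 0 < S0) (h1 : 0 < S1)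
    (h2 : 0 < S2) (h12 : 0 < S12)
    (M : Matrix (Fin 3) (Fin 4) ℝ)
    (hM : M = !![S0 * S1, S0 * S2, 0, 0;
                 0, S12 / S0, 1, 0;
                 0, -(S12 * S2) / (S0 * S1), 0, 1])
    (t : Fin 4 → ℝ) (ht : t = ![S12 / S2, S2 / S0, S0 / S1, S1 / S12])
    (E : Matrix (Fin 3) (Fin 4) ℝ)
    (hE : E = !![S12 / (S0 * S1 * S2), 1 / S0 ^ 2, 0, 0;
                 0, 0, S0 / S1, S2 / S12;
                 S0 / S2, 0, 0, S1 / S12]) :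
    -- (i) every 3 cyclically consecutive columns of `M` are linearly independent:
    (∀ i : ℤ, LinearIndependent ℝ (fun j : Fin 3 => colZ M (i + (j : ℤ)))) ∧
    -- (ii) the right twist exists, and `t · τ⃗(M) = E`:
    (∃ T : Matrix (Fin 3) (Fin 4) ℝ, IsRightTwist M T) ∧
    (∀ T : Matrix (Fin 3) (Fin 4) ℝ, IsRightTwist M T →
      Matrix.of (fun r c => t c * T r c) = E) ∧
    -- (iii) the 3×3 minors of `t · τ⃗(M)`:
    (minor3 E 0 1 2 = 1 / (S1 * S2) ∧ minor3 E 0 2 3 = 1 / (S1 * S2) ∧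
      minor3 E 0 1 3 = 1 / (S0 * S12) ∧ minor3 E 1 2 3 = 1 / (S0 * S12)) ∧
    -- (iv) the rows of `t · τ⃗(M)` are pairwise `Ω`-orthogonal (with `n = 2`):
    (∀ r r' : Fin 3, r ≠ r' → Omega 2 (fun c => E r c) (fun c => E r' c) = 0) := by
  have n0 := h0.ne'
  have n1 := h1.ne'
  have n2 := h2.ne'
  have n12 := h12.ne'
  refine ⟨?_, ?_, ?_, ?_, ?_⟩
  · apply linInd_aux
    intro c
    subst hM
    fin_cases c <;> simp [minor3, Matrix.det_fin_three, n0, n1, n2, n12]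
  · refine ⟨!![1 / (S0 * S1), 1 / (S0 * S2), 0, 0; 0, 0, 1, S2 / S1; S0 / S12, 0, 0, 1], ?_⟩
    rw [twist_iff_aux]
    intro c
    subst hM
    fin_cases c <;> simp <;> field_simp <;> simp
  · intro T hT
    rw [twist_iff_aux] at hT
    have a0 := hT 0
    have a1 := hT 1
    have a2 := hT 2
    have a3 := hT 3
    subst hM ht hE
    simp [n0, n1, n2, n12] at a0 a1 a2 a3
    obtain ⟨a, b, a10⟩ := a0
    obtain ⟨d, a11, a21⟩ := a1
    obtain ⟨a12, a22, a02⟩ := a2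
    obtain ⟨a23, a03, e⟩ := a3
    have a00 : T 0 0 = 1 / (S0 * S1) := by
      rw [eq_div_iff (mul_ne_zero n0 n1)]; exact a
    have a20 : T 2 0 = S0 / S12 := by
      rw [a00, a10] at b
      field_simp at b ⊢
      apply mul_left_cancel₀ n2
      linarith
    have a01 : T 0 1 = 1 / (S0 * S2) := by
      rw [a11, a21] at d
      rw [eq_div_iff (mul_ne_zero n0 n2)]; linarith
    have a13 : T 1 3 = S2 / S1 := by
      rw [a23, a03] at e
      field_simp at e ⊢
      apply mul_left_cancel₀ n12
      linarith
    ext r c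
    fin_cases r <;> fin_cases c <;>
      simp [a00, a10, a20, a01, a11, a21, a02, a12, a22, a03, a13, a23] <;> field_simp
  · subst hE
    refine ⟨?_, ?_, ?_, ?_⟩ <;> simp [minor3, Matrix.det_fin_three] <;> field_simp
  · intro r r' hr
    subst hE
    fin_cases r <;> fin_cases r' <;> simp [Omega, Fin.sum_univ_two] at hr ⊢ <;> field_simp <;> ring
end

section
/- Let n ≥ 2. Let M be an (n+1)×2n real matrix all of whose (n+1)×(n+1) minors are nonzero and of the same sign, and suppose the rows of M are pairwise Ω-orthogonal (so the row span of M is an (n+1)-dimensional subspace of ℝ^{2n} that is isotropic for Ω). For i ∈ ℤ, let S_i ⊆ [2n] denote the cyclic interval {i, i+1, …, i+n}, entries reduced modulo 2n to representatives in [2n]. Let t ∈ ℝ_{>0}^{2n} satisfy t_i · t_{n+i} = Δ_{S_{n+i}}(M) / Δ_{S_{n+i−1}}(M) for every i ∈ [n]. Then the row span Y of t·τ⃖(M) is an (n+1)-dimensional subspace of ℝ^{2n} that is coisotropic for Q, i.e. Y contains its Q-orthogonal complement Y^⊥ = {v ∈ ℝ^{2n} : Q(v,y) = 0 for all y ∈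 Y}. -/
open Matrix

/-- `T` is the left twist `τ⃖(M)`: its `i`-th column pairs to `1` with `M_i` and to `0`
with `M_j` for `i − k + 1 ≤ j < i`. -/
def IsLeftTwist {k N : ℕ} (M T : Matrix (Fin k) (Fin N) ℝ) : Prop :=
  ∀ i : ℤ,
    colZ T i ⬝ᵥ colZ M i = 1 ∧
    ∀ j : ℤ, i - (k : ℤ) + 1 ≤ j → j < i → colZ T i ⬝ᵥ colZ M j = 0

/-- The symmetric bilinear form `Q` on `ℝ^{2n}`:
`Q(x,y) = (1/2) Σ_{i=1}^{n} (−1)^{i−1} (x_i y_{n+i} + x_{n+i} y_i)`. -/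
noncomputable def Qform (n : ℕ) (x y : Fin (2 * n) → ℝ) : ℝ :=
  (1 / 2) * ∑ i : Fin n,
    (-1 : ℝ) ^ (i : ℕ) *
      (x ⟨i, by have := i.isLt; omega⟩ * y ⟨n + i, by have := i.isLt; omega⟩ +
        x ⟨n + i, by have := i.isLt; omega⟩ * y ⟨i, by have := i.isLt; omega⟩)

/-- The cyclic interval `S_a = {a, a+1, …, a+n}` of `n+1` residues modulo `2n`,
as a subset of `Fin (2n)` (zero-based). -/
def cycSet (n : ℕ) (a : ℕ) : Finset (Fin (2 * n)) :=
  if h : 0 < n then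
    (Finset.range (n + 1)).image (fun m => ⟨(a + m) % (2 * n), Nat.mod_lt _ (by omega)⟩)
  else ∅

/-- The minor of an `(n+1) × 2n` matrix on the set of columns `S` (taken in increasing
order); defined to be `0` if `S` does not have exactly `n+1` elements. -/
noncomputable def minorS (n : ℕ) (M : Matrix (Fin (n + 1)) (Fin (2 * n)) ℝ)
    (S : Finset (Fin (2 * n))) : ℝ :=
  if h : S.card = n + 1 then
    Matrix.det (M.submatrix id (fun j : Fin (n + 1) => ((S.orderIsoOfFin h j : S) : Fin (2 * n))))
  else 0


lemma zm_sum_range (N : ℕ) [NeZero N] (h : ZMod N → ℝ) :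
    ∑ z : ZMod N, h z = ∑ r ∈ Finset.range N, h (r : ZMod N) := by
  refine Finset.sum_bij (fun z _ => z.val) ?_ ?_ ?_ ?_
  · intro z _; simpa using ZMod.val_lt z
  · intro a _ b _ hab; exact ZMod.val_injective N hab
  · intro r hr
    exact ⟨(r : ZMod N), Finset.mem_univ _, ZMod.val_cast_of_lt (by simpa using hr)⟩
  · intro z _; simp

lemma zm_sum_shift (N : ℕ) [NeZero N] (m : ZMod N) (h : ZMod N → ℝ) :
    ∑ z : ZMod N, h z = ∑ r ∈ Finset.range N, h (m + (r : ZMod N)) := by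
  rw [← zm_sum_range N (fun z => h (m + z))]
  exact (Equiv.sum_comp (Equiv.addLeft m) h).symm

lemma zm_rep (N : ℕ) [NeZero N] (m j : ZMod N) : ∃ r : ℕ, r < N ∧ j = m + (r : ZMod N) :=
  ⟨(j - m).val, ZMod.val_lt _, by simp⟩

lemma zm_self (N : ℕ) : ((N : ℕ) : ZMod N) = 0 := ZMod.natCast_self N

/-- Sum of a window-supported function. -/
lemma win_sum (n : ℕ) (hn : 2 ≤ n) [NeZero (2 * n)] (m : ZMod (2 * n)) (h : ZMod (2 * n) → ℝ)
    (h0 : ∀ r : ℕ, n < r → r < 2 * n → h (m + (r : ZMod (2 * n))) = 0) :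
    ∑ z, h z = ∑ k : Fin (n + 1), h (m + ((k : ℕ) : ZMod (2 * n))) := by
  rw [zm_sum_shift _ m, Fin.sum_univ_eq_sum_range (fun k => h (m + (k : ZMod (2 * n))))]
  symm
  apply Finset.sum_subset
  · intro r; simp only [Finset.mem_range]; omega
  · intro r hr hr'
    simp only [Finset.mem_range] at hr hr'
    exact h0 r (by omega) hr

set_option linter.unusedSectionVars false

section Core
variable {n : ℕ} (c : ZMod (2 * n) → Fin (n + 1) → ℝ)

/-- Window matrix. -/
def winMat (m : ZMod (2 * n)) : Matrix (Fin (n + 1)) (Fin (n + 1)) ℝ :=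
  Matrix.of fun r k => c (m + ((k : ℕ) : ZMod (2 * n))) r

lemma win_uniq (hn : 2 ≤ n) [NeZero (2 * n)] (hdet : ∀ m, (winMat c m).det ≠ 0)
    (m : ZMod (2 * n)) (a : ZMod (2 * n) → ℝ)
    (h0 : ∀ r : ℕ, n < r → r < 2 * n → a (m + (r : ZMod (2 * n))) = 0)
    (hs : ∀ r, ∑ z, a z * c z r = 0) : a = 0 := by
  have h1 : winMat c m *ᵥ (fun k : Fin (n + 1) => a (m + ((k : ℕ) : ZMod (2 * n)))) = 0 := by
    ext r
    have := hs r
    rw [win_sum n hn m _ (fun r' h h' => by rw [h0 r' h h', zero_mul])] at this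
    simp only [Matrix.mulVec, dotProduct, winMat, Matrix.of_apply, Pi.zero_apply]
    rw [← this]
    exact Finset.sum_congr rfl fun k _ => mul_comm _ _
  have h2 := Matrix.eq_zero_of_mulVec_eq_zero (hdet m) h1
  ext j
  obtain ⟨r, hr, rfl⟩ := zm_rep _ m j
  by_cases hrn : n < r
  · simpa using h0 r hrn hr
  · simpa using congrFun h2 ⟨r, by omega⟩

lemma win_ex (hn : 2 ≤ n) [NeZero (2 * n)] (hdet : ∀ m, (winMat c m).det ≠ 0)
    (m : ZMod (2 * n)) (x : Fin (n + 1) → ℝ) : ∃ a : ZMod (2 * n) → ℝ,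
    (∀ r : ℕ, n < r → r < 2 * n → a (m + (r : ZMod (2 * n))) = 0) ∧
    (∀ r, ∑ z, a z * c z r = x r) := by
  classical
  let b : Fin (n + 1) → ℝ := (winMat c m)⁻¹ *ᵥ x
  have hb : winMat c m *ᵥ b = x := by
    simp only [b, Matrix.mulVec_mulVec]
    rw [Matrix.mul_nonsing_inv _ (isUnit_iff_ne_zero.mpr (hdet m)), Matrix.one_mulVec]
  let a : ZMod (2 * n) → ℝ := fun z => if h : (z - m).val < n + 1 then b ⟨(z - m).val, h⟩ else 0
  have h0 : ∀ r : ℕ, n < r → r < 2 * n → a (m + (r : ZMod (2 * n))) = 0 := by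
    intro r h1 h2
    have : (m + (r : ZMod (2 * n)) - m).val = r := by
      rw [add_sub_cancel_left, ZMod.val_cast_of_lt h2]
    simp only [a]
    rw [dif_neg (by omega)]
  refine ⟨a, h0, fun r => ?_⟩
  rw [win_sum n hn m _ (fun r' h h' => by rw [h0 r' h h', zero_mul]), ← hb]
  simp only [Matrix.mulVec, dotProduct, winMat, Matrix.of_apply]
  refine Finset.sum_congr rfl fun k _ => ?_
  have hk : (m + ((k : ℕ) : ZMod (2 * n)) - m).val = k := by
    rw [add_sub_cancel_left, ZMod.val_cast_of_lt (by omega)]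
  have : a (m + ((k : ℕ) : ZMod (2 * n))) = b k := by
    simp only [a]
    rw [dif_pos (by omega)]
    congr 1
    exact Fin.ext hk
  rw [this, mul_comm]

lemma win_dual (hdet : ∀ m, (winMat c m).det ≠ 0)
    (m : ZMod (2 * n)) (b : Fin (n + 1) → ℝ) : ∃ w : Fin (n + 1) → ℝ,
    ∀ k : Fin (n + 1), w ⬝ᵥ c (m + ((k : ℕ) : ZMod (2 * n))) = b k := by
  refine ⟨b ᵥ* (winMat c m)⁻¹, fun k => ?_⟩
  have : (b ᵥ* (winMat c m)⁻¹) ᵥ* winMat c m = b := by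
    rw [Matrix.vecMul_vecMul, Matrix.nonsing_inv_mul _ (isUnit_iff_ne_zero.mpr (hdet m)),
      Matrix.vecMul_one]
  exact congrFun this k

lemma dot_sum [NeZero (2 * n)] (w x : Fin (n + 1) → ℝ) (a : ZMod (2 * n) → ℝ)
    (h : ∀ r, ∑ z, a z * c z r = x r) : w ⬝ᵥ x = ∑ z, a z * (w ⬝ᵥ c z) := by
  simp only [dotProduct, ← h, Finset.mul_sum]
  rw [Finset.sum_comm]
  exact Finset.sum_congr rfl fun z _ => Finset.sum_congr rfl fun r _ => by ring

variable (T : ZMod (2 * n) → Fin (n + 1) → ℝ) (ω : ZMod (2 * n) → ℝ)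

/-- Contraction with the form. -/
def nb (j : ZMod (2 * n)) : Fin (n + 1) → ℝ := ω j • c (j + 1) - ω (j - 1) • c (j - 1)

lemma dot_nb (w : Fin (n + 1) → ℝ) (j : ZMod (2 * n)) :
    w ⬝ᵥ nb c ω j = ω j * (w ⬝ᵥ c (j + 1)) - ω (j - 1) * (w ⬝ᵥ c (j - 1)) := by
  simp [nb, dotProduct_sub, dotProduct_smul]

/-- Hypotheses bundle. -/
structure Core : Prop where
  hn : 2 ≤ n
  hdet : ∀ m, (winMat c m).det ≠ 0
  hω : ∀ j, ω j * ω j = 1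
  hiso : ∀ w r, ∑ z : Fin (2 * n), (w ⬝ᵥ nb c ω ((z : ℕ) : ZMod (2 * n))) * c ((z : ℕ) : ZMod (2 * n)) r = 0
  hT1 : ∀ m, T m ⬝ᵥ c m = 1
  hT0 : ∀ m, ∀ r : ℕ, n ≤ r → r < 2 * n → T m ⬝ᵥ c (m + (r : ZMod (2 * n))) = 0

variable {c T ω} (H : Core c T ω) [NeZero (2 * n)]
include H

lemma Core.iso (w : Fin (n + 1) → ℝ) (r : Fin (n + 1)) : ∑ z, (w ⬝ᵥ nb c ω z) * c z r = 0 := by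
  rw [zm_sum_range, ← H.hiso w r]
  exact (Fin.sum_univ_eq_sum_range (fun z => (w ⬝ᵥ nb c ω ((z : ℕ) : ZMod (2 * n))) * c ((z : ℕ) : ZMod (2 * n)) r) (2 * n)).symm

lemma Core.e_first (m : ZMod (2 * n)) : T m ⬝ᵥ nb c ω (m - 1) = ω (m - 1) := by
  have hn := H.hn
  rw [dot_nb, sub_add_cancel, H.hT1]
  have := H.hT0 m (2 * n - 2) (by omega) (by omega)
  rw [Nat.cast_sub (by omega), zm_self] at this
  rw [show m - 1 - 1 = m + (0 - ((2 : ℕ) : ZMod (2 * n))) by push_cast; ring, this]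
  ring

lemma Core.e_zero (m : ZMod (2 * n)) (r : ℕ) (h1 : n < r) (h2 : r < 2 * n - 1) :
    T m ⬝ᵥ nb c ω (m + r) = 0 := by
  have a1 := H.hT0 m (r + 1) (by omega) (by omega)
  have a2 := H.hT0 m (r - 1) (by omega) (by omega)
  rw [Nat.cast_sub (by omega)] at a2
  rw [dot_nb, show m + (r : ZMod (2 * n)) + 1 = m + ((r + 1 : ℕ) : ZMod (2 * n)) by push_cast; ring,
    show m + (r : ZMod (2 * n)) - 1 = m + ((r : ZMod (2 * n)) - ((1 : ℕ) : ZMod (2 * n))) by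
      push_cast; ring, a1, a2]
  ring

lemma Core.e_last (m : ZMod (2 * n)) :
    T m ⬝ᵥ nb c ω (m + n) = - ω (m + n - 1) * (T m ⬝ᵥ c (m + n - 1)) := by
  have hn := H.hn
  have a1 := H.hT0 m (n + 1) (by omega) (by omega)
  rw [dot_nb, show m + (n : ZMod (2 * n)) + 1 = m + ((n + 1 : ℕ) : ZMod (2 * n)) by push_cast; ring,
    a1]
  ring

omit H in
lemma two_n : (n : ZMod (2 * n)) + n = 0 := by
  have := zm_self (2 * n); push_cast at this; linear_combination this

lemma Core.d_ne (m : ZMod (2 * n)) : T m ⬝ᵥ c (m + n - 1) ≠ 0 := by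
  intro h
  have hn := H.hn
  obtain ⟨a, ha0, ha⟩ := win_ex c H.hn H.hdet (m + n - 1) (c m)
  have h1 := dot_sum c (T m) (c m) a ha
  rw [H.hT1, win_sum n hn (m + n - 1) _ (fun r h h' => by rw [ha0 r h h', zero_mul])] at h1
  rw [Finset.sum_eq_zero] at h1
  · norm_num at h1
  intro k _
  rcases Nat.eq_zero_or_pos (k : ℕ) with hk | hk
  · rw [hk, Nat.cast_zero, add_zero, h, mul_zero]
  · have := H.hT0 m (n + (k - 1)) (by omega) (by omega)
    rw [Nat.cast_add, Nat.cast_sub (by omega)] at this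
    rw [show m + (n : ZMod (2 * n)) - 1 + ((k : ℕ) : ZMod (2 * n)) =
      m + (n + (((k : ℕ) : ZMod (2 * n)) - ((1 : ℕ) : ZMod (2 * n)))) by push_cast; ring, this,
      mul_zero]

lemma Core.d_sym (m : ZMod (2 * n)) :
    ω (m - 1) * (T (m + n) ⬝ᵥ c (m + n + n - 1)) = ω (m + n - 1) * (T m ⬝ᵥ c (m + n - 1)) := by
  have hn := H.hn
  have h1 := dot_sum c (T (m + n)) 0 (fun z => T m ⬝ᵥ nb c ω z) (fun r => by
    simpa using H.iso (T m) r)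
  rw [dotProduct_zero, zm_sum_shift _ (m - 1)] at h1
  rw [Finset.sum_eq_add_of_mem 0 (n + 1) (by simp; omega) (by simp; omega) (by omega)] at h1
  · rw [show m - 1 + ((n + 1 : ℕ) : ZMod (2 * n)) = m + n by push_cast; ring,
      show m - 1 + ((0 : ℕ) : ZMod (2 * n)) = m - 1 by push_cast; ring, H.e_first, H.e_last,
      H.hT1] at h1
    rw [show m + (n : ZMod (2 * n)) + n - 1 = m - 1 by linear_combination two_n (n := n)]
    linear_combination -h1
  · intro r hr hne
    rw [Finset.mem_range] at hr
    rcases lt_or_ge r (n + 1) with h | h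
    · have := H.hT0 (m + n) (n + (r - 1)) (by omega) (by omega)
      rw [Nat.cast_add, Nat.cast_sub (by omega)] at this
      rw [show m - 1 + (r : ZMod (2 * n)) =
        m + n + (n + ((r : ZMod (2 * n)) - ((1 : ℕ) : ZMod (2 * n)))) by
          push_cast; linear_combination - two_n (n := n), this, mul_zero]
    · have := H.e_zero m (r - 1) (by omega) (by omega)
      rw [Nat.cast_sub (by omega)] at this
      rw [show m - 1 + (r : ZMod (2 * n)) = m + ((r : ZMod (2 * n)) - ((1 : ℕ) : ZMod (2 * n))) by
          push_cast; ring, this, zero_mul]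

/-- The step formula. -/
lemma Core.step (x : Fin (n + 1) → ℝ) (m : ZMod (2 * n)) (a b : ZMod (2 * n) → ℝ)
    (ha0 : ∀ r : ℕ, n < r → r < 2 * n → a (m - 1 + (r : ZMod (2 * n))) = 0)
    (ha : ∀ r, ∑ z, a z * c z r = x r)
    (hb0 : ∀ r : ℕ, n < r → r < 2 * n → b (m + (r : ZMod (2 * n))) = 0)
    (hb : ∀ r, ∑ z, b z * c z r = x r) (j : ZMod (2 * n)) :
    b j - a j = - (a (m - 1) * ω (m - 1) * (T m ⬝ᵥ nb c ω j)) := by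
  have hn := H.hn
  have key := win_uniq c H.hn H.hdet m
    (fun j => b j - a j + (a (m - 1) * ω (m - 1)) * (T m ⬝ᵥ nb c ω j)) ?_ ?_
  · have := congrFun key j
    simp only [Pi.zero_apply] at this
    linarith
  · intro r h1 h2
    rw [hb0 r h1 h2]
    by_cases hr : r = 2 * n - 1
    · have : m + (r : ZMod (2 * n)) = m - 1 := by
        rw [hr, Nat.cast_sub (by omega), zm_self]; push_cast; ring
      rw [this, H.e_first]
      linear_combination a (m - 1) * H.hω (m - 1)
    · rw [H.e_zero m r h1 (by omega)]
      have := ha0 (r + 1) (by omega) (by omega)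
      rw [show m - 1 + ((r + 1 : ℕ) : ZMod (2 * n)) = m + r by push_cast; ring] at this
      rw [this]; ring
  · intro r
    have := H.iso (T m) r
    simp only [add_mul, sub_mul, Finset.sum_add_distrib, Finset.sum_sub_distrib, ha, hb,
      mul_assoc, ← Finset.mul_sum]
    rw [this]; ring

lemma Core.coef (x : Fin (n + 1) → ℝ) (m : ZMod (2 * n)) (a : ZMod (2 * n) → ℝ)
    (ha0 : ∀ r : ℕ, n < r → r < 2 * n → a (m - 1 + (r : ZMod (2 * n))) = 0)
    (ha : ∀ r, ∑ z, a z * c z r = x r) :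
    T (m + n) ⬝ᵥ x = a (m - 1) * (T (m + n) ⬝ᵥ c (m + n + n - 1)) := by
  have hn := H.hn
  rw [dot_sum c _ x a ha, win_sum n hn (m - 1) _ (fun r h h' => by rw [ha0 r h h', zero_mul]),
    Finset.sum_eq_single (0 : Fin (n + 1))]
  · rw [show m + (n : ZMod (2 * n)) + n - 1 = m - 1 by linear_combination two_n (n := n)]
    simp
  · intro k _ hk
    have hk : 0 < (k : ℕ) := Fin.pos_iff_ne_zero.mpr hk
    have := H.hT0 (m + n) (n + (k - 1)) (by omega) (by omega)
    rw [Nat.cast_add, Nat.cast_sub (by omega)] at this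
    rw [show m - 1 + ((k : ℕ) : ZMod (2 * n)) =
        m + n + (n + (((k : ℕ) : ZMod (2 * n)) - ((1 : ℕ) : ZMod (2 * n)))) by
          push_cast; linear_combination - two_n (n := n), this, mul_zero]
  · simp

lemma Core.gram (x : Fin (n + 1) → ℝ) (j : ZMod (2 * n)) :
    ∑ m, ω (m - 1) / (T (m + n) ⬝ᵥ c (m + n + n - 1)) *
      ((T (m + n) ⬝ᵥ x) * (T m ⬝ᵥ nb c ω j)) = 0 := by
  choose a ha0 ha using fun m => win_ex c H.hn H.hdet m x
  have h1 : ∀ m, ω (m - 1) / (T (m + n) ⬝ᵥ c (m + n + n - 1)) *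
      ((T (m + n) ⬝ᵥ x) * (T m ⬝ᵥ nb c ω j)) = a (m - 1) j - a m j := by
    intro m
    have h2 := H.step x m (a (m - 1)) (a m) (ha0 _) (ha _) (ha0 _) (ha _) j
    rw [H.coef x m (a (m - 1)) (ha0 _) (ha _)]
    have hd := H.d_ne (m + n)
    field_simp
    linarith
  rw [Finset.sum_congr rfl fun m _ => h1 m, Finset.sum_sub_distrib, sub_eq_zero]
  exact Equiv.sum_comp (Equiv.subRight (1 : ZMod (2 * n))) (fun m => a m j)

lemma Core.inj (x : Fin (n + 1) → ℝ) (hx : ∀ m, T m ⬝ᵥ x = 0) : x = 0 := by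
  have hn := H.hn
  choose a ha0 ha using fun m => win_ex c H.hn H.hdet m x
  have h1 : ∀ m j, a m j = a (m - 1) j := by
    intro m j
    have h2 := H.step x m (a (m - 1)) (a m) (ha0 _) (ha _) (ha0 _) (ha _) j
    have h3 := H.coef x m (a (m - 1)) (ha0 _) (ha _)
    rw [hx] at h3
    have h4 : a (m - 1) (m - 1) = 0 := by
      rcases mul_eq_zero.mp h3.symm with h | h
      · exact h
      · exact absurd h (H.d_ne (m + n))
    rw [h4] at h2
    linarith
  have h2 : ∀ (r : ℕ) j, a (r : ZMod (2 * n)) j = a 0 j := by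
    intro r j
    induction r with
    | zero => simp
    | succ k ih => rw [h1, ← ih]; congr 1; push_cast; ring
  have h3 : ∀ j, a 0 j = 0 := by
    intro j
    have := ha0 (j + 1) (2 * n - 1) (by omega) (by omega)
    rw [Nat.cast_sub (by omega), zm_self,
      show j + 1 + (0 - ((1 : ℕ) : ZMod (2 * n))) = j by push_cast; ring] at this
    rw [← h2 (j + 1).val j, ZMod.natCast_zmod_val, this]
  ext r
  rw [← ha 0 r]
  simp [h3]

lemma Core.span_nb : n + 1 ≤ Module.finrank ℝ (Submodule.span ℝ (Set.range (nb c ω))) + 2 := by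
  set W := Submodule.span ℝ (Set.range (nb c ω))
  set K := Submodule.span ℝ (Set.range ![c 0, c 1])
  have hn := H.hn
  have hK : Module.finrank ℝ K ≤ 2 := by
    exact (finrank_range_le_card (R := ℝ) ![c 0, c 1]).trans (by simp)
  have hmem : ∀ r : ℕ, c (r : ZMod (2 * n)) ∈ W ⊔ K ∧ c ((r + 1 : ℕ) : ZMod (2 * n)) ∈ W ⊔ K := by
    intro r
    induction r with
    | zero =>
      refine ⟨Submodule.mem_sup_right (Submodule.subset_span ⟨0, by simp⟩),
        Submodule.mem_sup_right (Submodule.subset_span ⟨1, by simp⟩)⟩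
    | succ k ih =>
      refine ⟨ih.2, ?_⟩
      have hN : nb c ω ((k + 1 : ℕ) : ZMod (2 * n)) ∈ W ⊔ K :=
        Submodule.mem_sup_left (Submodule.subset_span ⟨_, rfl⟩)
      have : c ((k + 1 + 1 : ℕ) : ZMod (2 * n)) = ω ((k + 1 : ℕ) : ZMod (2 * n)) •
          (nb c ω ((k + 1 : ℕ) : ZMod (2 * n)) + ω (k : ZMod (2 * n)) • c (k : ZMod (2 * n))) := by
        have e1 : ((k + 1 : ℕ) : ZMod (2 * n)) - 1 = k := by push_cast; ring
        have e2 : ((k + 1 : ℕ) : ZMod (2 * n)) + 1 = ((k + 1 + 1 : ℕ) : ZMod (2 * n)) := by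
          push_cast; ring
        rw [nb, e1, e2, sub_add_cancel, smul_smul, H.hω, one_smul]
      rw [this]
      exact Submodule.smul_mem _ _ (Submodule.add_mem _ hN (Submodule.smul_mem _ _ ih.1))
  have htop : W ⊔ K = ⊤ := by
    rw [eq_top_iff]
    intro x _
    obtain ⟨a, -, ha⟩ := win_ex c H.hn H.hdet 0 x
    have : x = ∑ z, a z • c z := by
      ext r; rw [← ha r]; simp
    rw [this]
    refine Submodule.sum_mem _ fun z _ => Submodule.smul_mem _ _ ?_
    have := (hmem z.val).1
    rwa [ZMod.natCast_zmod_val] at this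
  have h1 := Submodule.finrank_add_le_finrank_add_finrank W K
  rw [htop, finrank_top, Module.finrank_fin_fun] at h1
  omega
end Core

/-- Columns indexed by `ZMod`. -/
noncomputable def cM {n : ℕ} (M : Matrix (Fin (n + 1)) (Fin (2 * n)) ℝ) (z : ZMod (2 * n)) :
    Fin (n + 1) → ℝ := colZ M (z.val : ℤ)

lemma colZ_eq {n : ℕ} [NeZero (2 * n)] (M : Matrix (Fin (n + 1)) (Fin (2 * n)) ℝ) (i : ℤ) :
    colZ M i = cM M (i : ZMod (2 * n)) := by
  ext r
  have := ZMod.val_intCast (n := 2 * n) i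
  simp only [cM, colZ, this, Int.emod_emod_of_dvd _ (dvd_refl _)]

lemma cM_lt {n : ℕ} [NeZero (2 * n)] (M : Matrix (Fin (n + 1)) (Fin (2 * n)) ℝ) (k : ℕ)
    (hk : k < 2 * n) (r) : cM M (k : ZMod (2 * n)) r = M r ⟨k, hk⟩ := by
  simp only [cM, colZ, ZMod.val_cast_of_lt hk]
  rw [dif_pos (by omega)]
  congr 2
  rw [Int.emod_eq_of_lt (by omega) (by exact_mod_cast hk)]
  simp

lemma cM_val {n : ℕ} [NeZero (2 * n)] (M : Matrix (Fin (n + 1)) (Fin (2 * n)) ℝ)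
    (z : ZMod (2 * n)) (r) : cM M z r = M r ⟨z.val, ZMod.val_lt z⟩ := by
  rw [← cM_lt M z.val (ZMod.val_lt z), ZMod.natCast_zmod_val]

lemma det_inj {n : ℕ} (M : Matrix (Fin (n + 1)) (Fin (2 * n)) ℝ)
    (hminors : ∀ f : Fin (n + 1) → Fin (2 * n), StrictMono f →
      Matrix.det (M.submatrix id f) ≠ 0) (f : Fin (n + 1) → Fin (2 * n))
    (hf : Function.Injective f) : Matrix.det (M.submatrix id f) ≠ 0 := by
  have h1 : StrictMono (f ∘ Tuple.sort f) :=
    (Tuple.monotone_sort f).strictMono_of_injective (hf.comp (Tuple.sort f).injective)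
  have h2 := hminors _ h1
  have h3 := Matrix.det_permute' (Tuple.sort f) (M.submatrix id f)
  rw [Matrix.submatrix_submatrix] at h3
  intro h
  rw [h, mul_zero] at h3
  exact h2 h3

lemma winMat_det {n : ℕ} (hn : 2 ≤ n) [NeZero (2 * n)] (M : Matrix (Fin (n + 1)) (Fin (2 * n)) ℝ)
    (hminors : ∀ f : Fin (n + 1) → Fin (2 * n), StrictMono f →
      Matrix.det (M.submatrix id f) ≠ 0) (m : ZMod (2 * n)) : (winMat (cM M) m).det ≠ 0 := by
  have : winMat (cM M) m = M.submatrix id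
      (fun k : Fin (n + 1) => ⟨(m + ((k : ℕ) : ZMod (2 * n))).val, ZMod.val_lt _⟩) := by
    ext r k
    simp [winMat, cM_val]
  rw [this]
  apply det_inj M hminors
  intro a b hab
  have h := ZMod.val_injective _ (Fin.mk.inj hab)
  have h := congrArg ZMod.val (add_left_cancel h)
  rw [ZMod.val_cast_of_lt (by omega), ZMod.val_cast_of_lt (by omega)] at h
  exact Fin.ext h

lemma sum_range_pairs (g : ℕ → ℝ) (n : ℕ) : ∑ j ∈ Finset.range (2 * n), g j =
    ∑ i ∈ Finset.range n, g (2 * i) + ∑ i ∈ Finset.range n, g (2 * i + 1) := by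
  induction n with
  | zero => simp
  | succ k ih =>
    rw [show 2 * (k + 1) = 2 * k + 1 + 1 by ring, Finset.sum_range_succ, Finset.sum_range_succ, ih,
      Finset.sum_range_succ, Finset.sum_range_succ]
    ring

lemma sum_range_halves (g : ℕ → ℝ) (n : ℕ) : ∑ j ∈ Finset.range (2 * n), g j =
    ∑ i ∈ Finset.range n, (g i + g (n + i)) := by
  rw [two_mul, Finset.sum_range_add, Finset.sum_add_distrib]

/-- Edge signs. -/
noncomputable def om (n : ℕ) (z : ZMod (2 * n)) : ℝ :=
  if z.val = 2 * n - 1 then (-1) ^ (n + 1) else (-1) ^ z.val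

lemma om_sq (n : ℕ) (z : ZMod (2 * n)) : om n z * om n z = 1 := by
  unfold om
  split_ifs <;> rw [← mul_pow] <;> simp

lemma om_lt (n : ℕ) (k : ℕ) (hk : k < 2 * n - 1) : om n (k : ZMod (2 * n)) = (-1) ^ k := by
  unfold om
  rw [ZMod.val_cast_of_lt (by omega), if_neg (by omega)]

lemma om_last (n : ℕ) (hn : 2 ≤ n) : om n ((2 * n - 1 : ℕ) : ZMod (2 * n)) = (-1) ^ (n + 1) := by
  unfold om
  rw [ZMod.val_cast_of_lt (by omega), if_pos rfl]

lemma omega_eq {n : ℕ} (hn : 2 ≤ n) [NeZero (2 * n)] (M : Matrix (Fin (n + 1)) (Fin (2 * n)) ℝ)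
    (r r' : Fin (n + 1)) : Omega n (fun j => M r j) (fun j => M r' j) =
    ∑ z, om n z * (cM M z r * cM M (z + 1) r' - cM M (z + 1) r * cM M z r') := by
  rw [zm_sum_range, sum_range_pairs]
  unfold Omega
  rw [dif_pos (by omega), add_assoc]
  congr 1
  · rw [← Fin.sum_univ_eq_sum_range (fun i => om n ((2 * i : ℕ) : ZMod (2 * n)) * _)]
    refine Finset.sum_congr rfl fun i _ => ?_
    have := i.isLt
    rw [om_lt n _ (by omega), ← Nat.cast_add_one]
    rw [cM_lt M _ (by omega), cM_lt M _ (by omega), cM_lt M _ (by omega), cM_lt M _ (by omega)]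
    simp
  · obtain ⟨k, rfl⟩ : ∃ k, n = k + 1 := ⟨n - 1, by omega⟩
    rw [Finset.sum_range_succ, ← Fin.sum_univ_eq_sum_range (fun i => om (k + 1) ((2 * i + 1 : ℕ) : ZMod (2 * (k + 1))) * _) k]
    congr 1
    · refine Finset.sum_congr rfl fun i _ => ?_
      have : (i : ℕ) < k := i.isLt
      rw [om_lt _ _ (by omega), ← Nat.cast_add_one]
      rw [cM_lt M _ (by omega), cM_lt M _ (by omega), cM_lt M _ (by omega), cM_lt M _ (by omega)]
      simp [pow_succ, pow_mul]
    · have e : ((2 * k + 1 : ℕ) : ZMod (2 * (k + 1))) + 1 = ((0 : ℕ) : ZMod (2 * (k + 1))) := by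
        have := zm_self (2 * (k + 1))
        push_cast at this ⊢
        linear_combination this
      have := om_last (k + 1) (by omega)
      rw [show 2 * (k + 1) - 1 = 2 * k + 1 by omega] at this
      rw [this, e]
      rw [cM_lt M _ (by omega), cM_lt M _ (by omega), cM_lt M _ (by omega), cM_lt M _ (by omega)]
      simp only [show 2 * (k + 1) - 1 = 2 * k + 1 by omega]
      ring

lemma omega_self (n : ℕ) (x : Fin (2 * n) → ℝ) : Omega n x x = 0 := by
  unfold Omega
  split_ifs
  · simp [mul_comm]
  · rfl

lemma iso_conv {n : ℕ} (hn : 2 ≤ n) [NeZero (2 * n)] (M : Matrix (Fin (n + 1)) (Fin (2 * n)) ℝ)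
    (hiso : ∀ r r' : Fin (n + 1), r ≠ r' →
      Omega n (fun j => M r j) (fun j => M r' j) = 0) (w : Fin (n + 1) → ℝ) (r : Fin (n + 1)) :
    ∑ z, (w ⬝ᵥ nb (cM M) (om n) z) * cM M z r = 0 := by
  have h1 : ∀ r', ∑ z, nb (cM M) (om n) z r' * cM M z r = 0 := by
    intro r'
    have h2 : Omega n (fun j => M r j) (fun j => M r' j) = 0 := by
      by_cases h : r = r'
      · subst h; exact omega_self _ _
      · exact hiso r r' h
    rw [omega_eq hn] at h2
    simp only [nb, Pi.sub_apply, Pi.smul_apply, smul_eq_mul, sub_mul, Finset.sum_sub_distrib]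
    simp only [mul_sub, Finset.sum_sub_distrib] at h2
    rw [← h2]
    congr 1
    · exact Finset.sum_congr rfl fun z _ => by ring
    · rw [← Equiv.sum_comp (Equiv.subRight (1 : ZMod (2 * n)))
        (fun z => om n z * (cM M (z + 1) r * cM M z r'))]
      refine Finset.sum_congr rfl fun z _ => ?_
      simp only [Equiv.subRight_apply, sub_add_cancel]
      ring
  simp only [dotProduct, Finset.sum_mul]
  rw [Finset.sum_comm]
  refine Finset.sum_eq_zero fun r' _ => ?_
  simp only [mul_assoc, ← Finset.mul_sum, h1, mul_zero]

lemma core_of {n : ℕ} (hn : 2 ≤ n) [NeZero (2 * n)] (M T : Matrix (Fin (n + 1)) (Fin (2 * n)) ℝ)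
    (hminors : ∀ f : Fin (n + 1) → Fin (2 * n), StrictMono f →
      Matrix.det (M.submatrix id f) ≠ 0)
    (hiso : ∀ r r' : Fin (n + 1), r ≠ r' →
      Omega n (fun j => M r j) (fun j => M r' j) = 0) (hT : IsLeftTwist M T) :
    Core (cM M) (cM T) (om n) where
  hn := hn
  hdet := winMat_det hn M hminors
  hω := om_sq n
  hiso := by
    intro w r
    have := iso_conv hn M hiso w r
    rw [zm_sum_range] at this
    rw [← this]
    exact (Fin.sum_univ_eq_sum_range (fun z => (w ⬝ᵥ nb (cM M) (om n) ((z : ℕ) : ZMod (2 * n))) * cM M ((z : ℕ) : ZMod (2 * n)) r) (2 * n))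
  hT1 := by
    intro m
    have := (hT (m.val : ℤ)).1
    rw [colZ_eq, colZ_eq] at this
    simpa using this
  hT0 := by
    intro m r h1 h2
    have := (hT (m.val : ℤ)).2 (m.val - (2 * n : ℕ) + r) (by push_cast; omega) (by push_cast; omega)
    rw [colZ_eq, colZ_eq] at this
    rw [← this]
    congr 2
    · simp
    · have := zm_self (2 * n)
      rw [Int.cast_add, Int.cast_sub, Int.cast_natCast, Int.cast_natCast, Int.cast_natCast, this]
      simp

lemma twist_ex {n : ℕ} (hn : 2 ≤ n) [NeZero (2 * n)] (M : Matrix (Fin (n + 1)) (Fin (2 * n)) ℝ)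
    (hminors : ∀ f : Fin (n + 1) → Fin (2 * n), StrictMono f →
      Matrix.det (M.submatrix id f) ≠ 0) :
    ∃ T : Matrix (Fin (n + 1)) (Fin (2 * n)) ℝ, IsLeftTwist M T := by
  choose w hw using fun m : ZMod (2 * n) => win_dual (cM M) (winMat_det hn M hminors) (m - n)
    (fun k => if (k : ℕ) = n then 1 else 0)
  obtain ⟨T, hT⟩ : ∃ T : Matrix (Fin (n + 1)) (Fin (2 * n)) ℝ,
      T = Matrix.of fun r (j : Fin (2 * n)) => w ((j : ℕ) : ZMod (2 * n)) r := ⟨_, rfl⟩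
  refine ⟨T, fun i => ?_⟩
  have e : ∀ z : ZMod (2 * n), cM T z = w z := by
    intro z
    ext r
    rw [cM_val, hT]
    simp
  rw [colZ_eq T, e]
  refine ⟨?_, fun j hj1 hj2 => ?_⟩
  · have := hw (i : ZMod (2 * n)) ⟨n, by omega⟩
    rw [colZ_eq]
    simpa using this
  · have := hw (i : ZMod (2 * n)) ⟨(j - i + n).toNat, by push_cast at hj1; omega⟩
    rw [colZ_eq]
    push_cast at hj1
    rw [if_neg (by simp only; omega)] at this
    rw [← this]
    congr 2
    have h3 : (((j - i + n).toNat : ℤ)) = j - i + n := Int.toNat_of_nonneg (by omega)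
    have h4 := congrArg (Int.cast : ℤ → ZMod (2 * n)) h3
    rw [Int.cast_natCast] at h4
    simp only [h4]
    push_cast
    ring

/-- Sorted cyclic interval. -/
def gp (n p : ℕ) (hp : p ≤ n) (hn : 2 ≤ n) (k : Fin (n + 1)) : Fin (2 * n) :=
  if h : (k : ℕ) < p then ⟨k, by omega⟩ else ⟨n - 1 + k, by omega⟩

lemma gp_mono (n p : ℕ) (hp : p ≤ n) (hn : 2 ≤ n) : StrictMono (gp n p hp hn) := by
  intro a b hab
  have : (a : ℕ) < b := hab
  unfold gp
  split_ifs <;> simp only [Fin.mk_lt_mk] <;> omega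

lemma gp_minor (n p a : ℕ) (hp : p ≤ n) (hn : 2 ≤ n) (ha : a + 1 = n + p)
    (M : Matrix (Fin (n + 1)) (Fin (2 * n)) ℝ) :
    minorS n M (cycSet n a) = (M.submatrix id (gp n p hp hn)).det := by
  have hset : cycSet n a = Finset.univ.image (gp n p hp hn) := by
    ext j
    unfold cycSet
    rw [dif_pos (by omega)]
    simp only [Finset.mem_image, Finset.mem_range, Finset.mem_univ, true_and]
    constructor
    · rintro ⟨m, hm, rfl⟩
      by_cases h : a + m < 2 * n
      · refine ⟨⟨p + m, by omega⟩, ?_⟩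
        unfold gp
        rw [dif_neg (by simp)]
        apply Fin.ext
        simp only [Nat.mod_eq_of_lt h]
        omega
      · refine ⟨⟨a + m - 2 * n, by omega⟩, ?_⟩
        unfold gp
        rw [dif_pos (by simp only; omega)]
        apply Fin.ext
        simp only
        rw [Nat.mod_eq_sub_mod (by omega), Nat.mod_eq_of_lt (by omega)]
    · rintro ⟨k, rfl⟩
      unfold gp
      split_ifs with h
      · refine ⟨2 * n + k - a, by omega, ?_⟩
        apply Fin.ext
        simp only
        rw [show a + (2 * n + k - a) = k + 2 * n by omega, Nat.add_mod_right,
          Nat.mod_eq_of_lt (by omega)]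
      · refine ⟨k - p, by omega, ?_⟩
        apply Fin.ext
        simp only
        rw [Nat.mod_eq_of_lt (by omega)]
        omega
  have hcard : (cycSet n a).card = n + 1 := by
    rw [hset, Finset.card_image_of_injective _ (gp_mono n p hp hn).injective]
    simp
  unfold minorS
  rw [dif_pos hcard]
  have := Finset.orderEmbOfFin_unique hcard (f := gp n p hp hn)
    (fun x => by rw [hset]; simp) (gp_mono n p hp hn)
  congr 2
  rw [this]
  rfl

lemma minor_ratio {n : ℕ} (hn : 2 ≤ n) [NeZero (2 * n)] {M T : Matrix (Fin (n + 1)) (Fin (2 * n)) ℝ}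
    (hminors : ∀ f : Fin (n + 1) → Fin (2 * n), StrictMono f →
      Matrix.det (M.submatrix id f) ≠ 0)
    (H : Core (cM M) (cM T) (om n)) (i : ℕ) (hi : i < n) :
    minorS n M (cycSet n (n + i)) / minorS n M (cycSet n (n + i - 1)) =
      (cM T (i : ZMod (2 * n)) ⬝ᵥ cM M ((i : ZMod (2 * n)) + n - 1))⁻¹ := by
  rw [gp_minor n (i + 1) (n + i) (by omega) hn (by omega),
    gp_minor n i (n + i - 1) (by omega) hn (by omega)]
  set A := M.submatrix id (gp n (i + 1) (by omega) hn) with hA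
  set B := M.submatrix id (gp n i (by omega) hn) with hB
  set w := cM T (i : ZMod (2 * n))
  have hdB : B.det ≠ 0 := hminors _ (gp_mono _ _ _ _)
  have hdA : A.det ≠ 0 := hminors _ (gp_mono _ _ _ _)
  have e : (i : ZMod (2 * n)) + n - 1 = ((n + i - 1 : ℕ) : ZMod (2 * n)) := by
    rw [Nat.cast_sub (by omega)]; push_cast; ring
  set b := cM M ((i : ZMod (2 * n)) + n - 1) with hb
  have hBA : B = A.updateCol ⟨i, by omega⟩ b := by
    ext r k
    rw [Matrix.updateCol_apply, hb, e, cM_lt M _ (by omega)]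
    simp only [hA, hB, Matrix.submatrix_apply, id, gp]
    by_cases hk : k = ⟨i, by omega⟩
    · rw [if_pos hk, dif_neg (by simp [hk])]
      congr 2
      rw [hk]; simp only; omega
    · rw [if_neg hk]
      have : (k : ℕ) ≠ i := fun h => hk (Fin.ext h)
      by_cases h : (k : ℕ) < i
      · rw [dif_pos h, dif_pos (by omega)]
      · rw [dif_neg h, dif_neg (by omega)]
  have hwA : w ᵥ* A = Pi.single ⟨i, by omega⟩ 1 := by
    ext k
    have hcol : (w ᵥ* A) k = w ⬝ᵥ cM M (((gp n (i + 1) (by omega) hn k : Fin (2 * n)) : ℕ) : ZMod (2 * n)) := by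
      simp only [Matrix.vecMul, dotProduct]
      refine Finset.sum_congr rfl fun r _ => ?_
      rw [cM_lt M _ (Fin.isLt _)]
      rfl
    rw [hcol]
    by_cases hk : k = ⟨i, by omega⟩
    · rw [hk, Pi.single_eq_same]
      simp only [gp]
      rw [dif_pos (by simp)]
      exact H.hT1 _
    · rw [Pi.single_eq_of_ne hk]
      have : (k : ℕ) ≠ i := fun h => hk (Fin.ext h)
      simp only [gp]
      by_cases h : (k : ℕ) < i
      · rw [dif_pos (by omega)]
        have h0 := H.hT0 (i : ZMod (2 * n)) (2 * n - i + k) (by omega) (by omega)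
        rw [← h0]
        congr 2
        rw [Nat.cast_add, Nat.cast_sub (by omega), zm_self]
        simp
      · rw [dif_neg (by omega)]
        have h0 := H.hT0 (i : ZMod (2 * n)) (n - 1 + k - i) (by omega) (by omega)
        rw [← h0]
        congr 2
        rw [← Nat.cast_add]
        congr 1
        simp only
        omega
  have hdet : B.det = A.det * (w ⬝ᵥ b) := by
    have h1 : A.det • w = Pi.single ⟨i, by omega⟩ 1 ᵥ* A.adjugate := by
      rw [← hwA, Matrix.vecMul_vecMul, Matrix.mul_adjugate, Matrix.vecMul_smul, Matrix.vecMul_one]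
    rw [hBA, ← Matrix.cramer_apply, Matrix.cramer_eq_adjugate_mulVec, ← smul_eq_mul,
      ← smul_dotProduct, h1, Matrix.single_one_vecMul]
    rfl
  rw [hdet] at hdB ⊢
  have := right_ne_zero_of_mul hdB
  field_simp

/-- `Qform` as a bilinear form. -/
noncomputable def Qbil (n : ℕ) : LinearMap.BilinForm ℝ (Fin (2 * n) → ℝ) :=
  LinearMap.mk₂ ℝ (Qform n)
    (fun x y z => by
      simp only [Qform, Pi.add_apply, ← mul_add, ← Finset.sum_add_distrib]
      congr 1; exact Finset.sum_congr rfl fun i _ => by ring)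
    (fun a y z => by
      simp only [Qform, Pi.smul_apply, smul_eq_mul, Finset.mul_sum]
      exact Finset.sum_congr rfl fun i _ => by ring)
    (fun x y z => by
      simp only [Qform, Pi.add_apply, ← mul_add, ← Finset.sum_add_distrib]
      congr 1; exact Finset.sum_congr rfl fun i _ => by ring)
    (fun a y z => by
      simp only [Qform, Pi.smul_apply, smul_eq_mul, Finset.mul_sum]
      exact Finset.sum_congr rfl fun i _ => by ring)

lemma Qbil_apply (n : ℕ) (x y) : Qbil n x y = Qform n x y := rfl

lemma Qform_comm (n : ℕ) (x y) : Qform n x y = Qform n y x := by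
  unfold Qform
  congr 1; exact Finset.sum_congr rfl fun i _ => by ring

lemma Qsep (n : ℕ) (x : Fin (2 * n) → ℝ) (h : ∀ y, Qform n x y = 0) : x = 0 := by
  classical
  have key1 : ∀ i : Fin n, x ⟨i, by omega⟩ = 0 := by
    intro i
    have := h (Pi.single ⟨n + i, by omega⟩ 1)
    unfold Qform at this
    rw [Finset.sum_eq_single i] at this
    · have e : (⟨(i : ℕ), by omega⟩ : Fin (2 * n)) ≠ ⟨n + i, by omega⟩ := by
        intro h; have := Fin.mk.inj h; omega
      simpa [Pi.single_eq_of_ne e] using this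
    · intro k _ hk
      have e1 : (⟨(k : ℕ), by omega⟩ : Fin (2 * n)) ≠ ⟨n + i, by omega⟩ := by
        intro h; have := Fin.mk.inj h; omega
      have e2 : (⟨n + (k : ℕ), by omega⟩ : Fin (2 * n)) ≠ ⟨n + i, by omega⟩ := by
        simpa using fun h => hk (Fin.ext h)
      rw [Pi.single_eq_of_ne e1, Pi.single_eq_of_ne e2]; ring
    · simp
  have key2 : ∀ i : Fin n, x ⟨n + i, by omega⟩ = 0 := by
    intro i
    have := h (Pi.single ⟨i, by omega⟩ 1)
    unfold Qform at this
    rw [Finset.sum_eq_single i] at this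
    · have e : (⟨n + (i : ℕ), by omega⟩ : Fin (2 * n)) ≠ ⟨i, by omega⟩ := by
        intro h; have := Fin.mk.inj h; omega
      simpa [Pi.single_eq_of_ne e] using this
    · intro k _ hk
      have e1 : (⟨n + (k : ℕ), by omega⟩ : Fin (2 * n)) ≠ ⟨i, by omega⟩ := by
        intro h; have := Fin.mk.inj h; omega
      have e2 : (⟨(k : ℕ), by omega⟩ : Fin (2 * n)) ≠ ⟨i, by omega⟩ := by
        simpa using fun h => hk (Fin.ext h)
      rw [Pi.single_eq_of_ne e1, Pi.single_eq_of_ne e2]; ring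
    · simp
  ext j
  by_cases hj : (j : ℕ) < n
  · exact key1 ⟨j, hj⟩
  · have := key2 ⟨j - n, by omega⟩
    have e : (⟨n + (j - n), by omega⟩ : Fin (2 * n)) = j := Fin.ext (by simp only; omega)
    simp only [e] at this
    exact this

lemma Qnondeg (n : ℕ) : (Qbil n).Nondegenerate :=
  ⟨fun x h => Qsep n x h, fun x h => Qsep n x fun y => by rw [Qform_comm]; exact h y⟩

/-- The parametrization of the row span. -/
noncomputable def Fm {n : ℕ} (t : Fin (2 * n) → ℝ) (T : Matrix (Fin (n + 1)) (Fin (2 * n)) ℝ) :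
    (Fin (n + 1) → ℝ) →ₗ[ℝ] (Fin (2 * n) → ℝ) :=
  Fintype.linearCombination ℝ (fun r : Fin (n + 1) => (fun j => t j * T r j))

lemma Fm_apply {n : ℕ} [NeZero (2 * n)] (t : Fin (2 * n) → ℝ)
    (T : Matrix (Fin (n + 1)) (Fin (2 * n)) ℝ)
    (x) (j : ℕ) (hj : j < 2 * n) :
    Fm t T x ⟨j, hj⟩ = t ⟨j, hj⟩ * (cM T (j : ZMod (2 * n)) ⬝ᵥ x) := by
  simp only [Fm, Fintype.linearCombination_apply, Finset.sum_apply, Pi.smul_apply, smul_eq_mul,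
    dotProduct, Finset.mul_sum, cM_lt T j hj]
  exact Finset.sum_congr rfl fun i _ => by ring

lemma lt_two {n : ℕ} (i : Fin n) : (i : ℕ) < 2 * n := by have := i.isLt; omega

lemma add_lt_two {n : ℕ} (i : Fin n) : n + (i : ℕ) < 2 * n := by have := i.isLt; omega

lemma final {n : ℕ} (hn : 2 ≤ n) [NeZero (2 * n)] {M T : Matrix (Fin (n + 1)) (Fin (2 * n)) ℝ}
    (hminors : ∀ f : Fin (n + 1) → Fin (2 * n), StrictMono f →
      Matrix.det (M.submatrix id f) ≠ 0)
    (H : Core (cM M) (cM T) (om n))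
    (t : Fin (2 * n) → ℝ) (htpos : ∀ i, 0 < t i)
    (ht : ∀ i : Fin n,
      t ⟨i, lt_two i⟩ * t ⟨n + i, add_lt_two i⟩ =
        minorS n M (cycSet n (n + i)) / minorS n M (cycSet n (n + i - 1))) :
    Module.finrank ℝ
        (Submodule.span ℝ (Set.range fun r : Fin (n + 1) => (fun j => t j * T r j))) =
        n + 1 ∧
      (∀ v : Fin (2 * n) → ℝ,
        (∀ y ∈ Submodule.span ℝ (Set.range fun r : Fin (n + 1) => (fun j => t j * T r j)),
          Qform n v y = 0) →
        v ∈ Submodule.span ℝ (Set.range fun r : Fin (n + 1) => (fun j => t j * T r j))) := by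
  have hY : Submodule.span ℝ (Set.range fun r : Fin (n + 1) => (fun j => t j * T r j)) =
      LinearMap.range (Fm t T) := (Fintype.range_linearCombination ℝ _).symm
  have hinj : Function.Injective (Fm t T) := by
    rw [← LinearMap.ker_eq_bot, LinearMap.ker_eq_bot']
    intro x hx
    apply H.inj
    intro m
    have := congrFun hx ⟨m.val, ZMod.val_lt m⟩
    rw [Fm_apply, ZMod.natCast_zmod_val] at this
    exact (mul_eq_zero.mp this).resolve_left (htpos _).ne'
  rw [hY]
  have hfin : Module.finrank ℝ (LinearMap.range (Fm t T)) = n + 1 := by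
    rw [LinearMap.finrank_range_of_inj hinj, Module.finrank_fin_fun]
  refine ⟨hfin, ?_⟩
  have hgram : ∀ x j, Qform n (Fm t T x) (Fm t T (nb (cM M) (om n) j)) = 0 := by
    intro x j
    have h1 := H.gram x j
    rw [zm_sum_range, sum_range_halves,
      ← Fin.sum_univ_eq_sum_range (fun i : ℕ => _ + _)] at h1
    unfold Qform
    have h2 : (-1 : ℝ) ^ (n + 1) * ∑ i : Fin n, (-1 : ℝ) ^ (i : ℕ) *
      (Fm t T x ⟨i, lt_two i⟩ * Fm t T (nb (cM M) (om n) j) ⟨n + i, add_lt_two i⟩ +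
        Fm t T x ⟨n + i, add_lt_two i⟩ * Fm t T (nb (cM M) (om n) j) ⟨i, lt_two i⟩) = 0 := by
      rw [← h1, Finset.mul_sum]
      refine Finset.sum_congr rfl fun i _ => ?_
      simp only [Fm_apply]
      have hr := (ht i).trans (minor_ratio hn hminors H i i.isLt)
      have hs := H.d_sym ((i : ℕ) : ZMod (2 * n))
      have hd1 := H.d_ne ((i : ℕ) : ZMod (2 * n))
      have hd2 := H.d_ne (((i : ℕ) : ZMod (2 * n)) + n)
      have e0 : ((n + i : ℕ) : ZMod (2 * n)) = ((i : ℕ) : ZMod (2 * n)) + n := by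
        push_cast; ring
      have e1 : ((i : ℕ) : ZMod (2 * n)) + n + n = ((i : ℕ) : ZMod (2 * n)) := by
        linear_combination two_n (n := n)
      have ho : om n (((i : ℕ) : ZMod (2 * n)) + n - 1) = (-1) ^ (n + 1) * (-1) ^ (i : ℕ) := by
        have : ((i : ℕ) : ZMod (2 * n)) + n - 1 = ((n + i - 1 : ℕ) : ZMod (2 * n)) := by
          rw [Nat.cast_sub (by omega)]; push_cast; ring
        rw [this, om_lt _ _ (by omega), ← pow_add, show n + 1 + (i : ℕ) = n + i - 1 + 2 by omega,
          pow_add]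
        norm_num
      have hso := om_sq n (((i : ℕ) : ZMod (2 * n)) - 1)
      have hso2 := om_sq n (((i : ℕ) : ZMod (2 * n)) + n - 1)
      rw [e0]
      rw [e1] at hs hd2 ⊢
      rw [← mul_assoc, ← ho]
      generalize om n (((i : ℕ) : ZMod (2 * n)) + n - 1) = o2 at *
      generalize om n (((i : ℕ) : ZMod (2 * n)) - 1) = o1 at *
      generalize cM T ((i : ℕ) : ZMod (2 * n)) ⬝ᵥ cM M (((i : ℕ) : ZMod (2 * n)) + n - 1) = d1 at *
      generalize cM T (((i : ℕ) : ZMod (2 * n)) + n) ⬝ᵥ cM M (((i : ℕ) : ZMod (2 * n)) - 1) = d2 at *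
      have hq : o1 / d2 = o2 / d1 := by
        rw [div_eq_div_iff hd2 hd1]
        linear_combination (-o1 * o2 * 1) * hs + d2 * o2 * hso - d1 * o1 * hso2
      rw [hq, div_eq_mul_inv, ← hr]
      ring
    have h3 := (mul_eq_zero.mp h2).resolve_left (by simp)
    rw [h3, mul_zero]
  have hle : (Submodule.span ℝ (Set.range (nb (cM M) (om n)))).map (Fm t T) ≤
      (Qbil n).orthogonal (LinearMap.range (Fm t T)) := by
    rw [Submodule.map_le_iff_le_comap, Submodule.span_le]
    rintro _ ⟨j, rfl⟩
    rw [SetLike.mem_coe, Submodule.mem_comap, LinearMap.BilinForm.mem_orthogonal_iff]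
    rintro _ ⟨x, rfl⟩
    exact hgram x j
  have hrank : Module.finrank ℝ ((Qbil n).orthogonal (LinearMap.range (Fm t T))) ≤
      Module.finrank ℝ ((Submodule.span ℝ (Set.range (nb (cM M) (om n)))).map (Fm t T)) := by
    rw [LinearMap.BilinForm.finrank_orthogonal (Qnondeg n), hfin, Module.finrank_fin_fun,
      ← (Submodule.equivMapOfInjective _ hinj _).finrank_eq]
    have := H.span_nb
    omega
  have heq := Submodule.eq_of_le_of_finrank_le hle hrank
  intro v hv
  have hmem : v ∈ (Qbil n).orthogonal (LinearMap.range (Fm t T)) := by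
    rw [LinearMap.BilinForm.mem_orthogonal_iff]
    intro y hy
    rw [Qbil_apply, Qform_comm]
    exact hv y hy
  rw [← heq] at hmem
  obtain ⟨w, -, rfl⟩ := hmem
  exact ⟨w, rfl⟩

theorem twisted_isotropic_is_coisotropic (n : ℕ) (hn : 2 ≤ n)
    (M : Matrix (Fin (n + 1)) (Fin (2 * n)) ℝ)
    -- all (n+1)×(n+1) minors of M are nonzero and of the same sign:
    (hminors : ∀ f : Fin (n + 1) → Fin (2 * n), StrictMono f →
      Matrix.det (M.submatrix id f) ≠ 0)
    (hsign : ∀ f g : Fin (n + 1) → Fin (2 * n), StrictMono f → StrictMono g →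
      0 < Matrix.det (M.submatrix id f) * Matrix.det (M.submatrix id g))
    -- the rows of M are pairwise Ω-orthogonal:
    (hiso : ∀ r r' : Fin (n + 1), r ≠ r' →
      Omega n (fun j => M r j) (fun j => M r' j) = 0)
    (t : Fin (2 * n) → ℝ) (htpos : ∀ i, 0 < t i)
    -- `t_i · t_{n+i} = Δ_{S_{n+i}}(M) / Δ_{S_{n+i−1}}(M)` for every `i ∈ [n]`:
    (ht : ∀ i : Fin n,
      t ⟨i, by have := i.isLt; omega⟩ * t ⟨n + i, by have := i.isLt; omega⟩ =
        minorS n M (cycSet n (n + i)) / minorS n M (cycSet n (n + i - 1))) :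
    -- the left twist of `M` exists, and the row span of `t·τ⃖(M)` is an
    -- (n+1)-dimensional coisotropic subspace for `Q`:
    (∃ T : Matrix (Fin (n + 1)) (Fin (2 * n)) ℝ, IsLeftTwist M T) ∧
    (∀ T : Matrix (Fin (n + 1)) (Fin (2 * n)) ℝ, IsLeftTwist M T →
      Module.finrank ℝ
        (Submodule.span ℝ (Set.range fun r : Fin (n + 1) => (fun j => t j * T r j))) =
        n + 1 ∧
      (∀ v : Fin (2 * n) → ℝ,
        (∀ y ∈ Submodule.span ℝ (Set.range fun r : Fin (n + 1) => (fun j => t j * T r j)),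
          Qform n v y = 0) →
        v ∈ Submodule.span ℝ (Set.range fun r : Fin (n + 1) => (fun j => t j * T r j)))) := by
  have : NeZero (2 * n) := ⟨by omega⟩
  exact ⟨twist_ex hn M hminors, fun T hT =>
    final hn hminors (core_of hn M T hminors hiso hT) t htpos ht⟩
end

section
/- Let c > 0 and let M be the 3×4 real matrix with rows (0, 1, 0, −1), (1, 0, 0, c), (0, 0, −1, −c). Then: (i) the rows of M are pairwise Ω-orthogonal for the form Ω on ℝ^4 with n = 2; (ii) the 3×3 minors of M are Δ_{123} = 1, Δ_{124} = c, Δ_{134} = 1, Δ_{234} = c; (iii) for any t_3, t_4 > 0, setting t = (1/(c t_3), c/t_4, t_3, t_4), one has the equality of matrices t·τ⃖(M) = [[1/t_3, c/t_4, 0, 0], [1/(t_3 c), 0, 0, t_4/c], [0, −1/t_4, −t_3, 0]]; (iv) the vector v = (1/(t_3 t_4), c/t_4², c t_3/t_4, 1) satisfies Q(v, y) = 0 for every row y of t·τ⃖(M) and Q(v,v) = 0, and v lies in the row span of t·τ⃖(M); hence the row span of t·τ⃖(M) is coisotropic for Q (with n = 2). -/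
open Matrix

theorem left_twist_coisotropic_example (c : ℝ) (hc : 0 < c)
    (M : Matrix (Fin 3) (Fin 4) ℝ)
    (hM : M = !![0, 1, 0, -1; 1, 0, 0, c; 0, 0, -1, -c]) :
    -- (i) the rows of `M` are pairwise `Ω`-orthogonal (with `n = 2`):
    (∀ r r' : Fin 3, r ≠ r' → Omega 2 (fun j => M r j) (fun j => M r' j) = 0) ∧
    -- (ii) the 3×3 minors of `M`:
    (minor3 M 0 1 2 = 1 ∧ minor3 M 0 1 3 = c ∧ minor3 M 0 2 3 = 1 ∧
      minor3 M 1 2 3 = c) ∧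
    -- the left twist of `M` exists:
    (∃ T : Matrix (Fin 3) (Fin 4) ℝ, IsLeftTwist M T) ∧
    -- (iii) & (iv):
    (∀ t3 t4 : ℝ, 0 < t3 → 0 < t4 →
      ∀ t : Fin 4 → ℝ, t = ![1 / (c * t3), c / t4, t3, t4] →
      ∀ T : Matrix (Fin 3) (Fin 4) ℝ, IsLeftTwist M T →
      ∀ E : Matrix (Fin 3) (Fin 4) ℝ,
        E = !![1 / t3, c / t4, 0, 0;
               1 / (t3 * c), 0, 0, t4 / c;
               0, -(1 / t4), -t3, 0] →
      -- (iii) the equality `t·τ⃖(M) = E`: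
      Matrix.of (fun r j => t j * T r j) = E ∧
      -- (iv) for `v = (1/(t3 t4), c/t4², c t3/t4, 1)`:
      ∀ v : Fin 4 → ℝ, v = ![1 / (t3 * t4), c / t4 ^ 2, c * t3 / t4, 1] →
        (∀ r : Fin 3, Qform 2 v (fun j => E r j) = 0) ∧
        Qform 2 v v = 0 ∧
        v ∈ Submodule.span ℝ (Set.range fun r : Fin 3 => (fun j => E r j)) ∧
        -- hence the row span of `t·τ⃖(M)` is coisotropic for `Q`:
        (∀ u : Fin 4 → ℝ,
          (∀ y ∈ Submodule.span ℝ (Set.range fun r : Fin 3 => (fun j => E r j)),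
            Qform 2 u y = 0) →
          u ∈ Submodule.span ℝ (Set.range fun r : Fin 3 => (fun j => E r j)))) := by
  have hc' : c ≠ 0 := hc.ne'
  subst hM
  have hQ : ∀ x y : Fin 4 → ℝ, Qform 2 x y =
      1 / 2 * (x 0 * y 2 + x 2 * y 0 - (x 1 * y 3 + x 3 * y 1)) := by
    intro x y
    have h : Qform 2 x y = 1 / 2 * ∑ i : Fin 2, (-1 : ℝ) ^ (i : ℕ) *
      (x ⟨i, by omega⟩ * y ⟨2 + i, by omega⟩ + x ⟨2 + i, by omega⟩ * y ⟨i, by omega⟩) := rfl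
    rw [h, Fin.sum_univ_two]
    have e : ((-1 : ℝ) ^ ((0 : Fin 2) : ℕ) *
      (x 0 * y 2 + x 2 * y 0) + (-1 : ℝ) ^ ((1 : Fin 2) : ℕ) *
      (x 1 * y 3 + x 3 * y 1)) = x 0 * y 2 + x 2 * y 0 - (x 1 * y 3 + x 3 * y 1) := by
      simp; ring
    rw [← e]; rfl
  have hO : ∀ x y : Fin 4 → ℝ, Omega 2 x y =
      ((x 0 * y 1 - x 1 * y 0) + (x 2 * y 3 - x 3 * y 2)) + (x 2 * y 1 - x 1 * y 2)
        + (-1) ^ 2 * (x 0 * y 3 - x 3 * y 0) := by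
    intro x y
    unfold Omega
    rw [dif_pos (by norm_num), Fin.sum_univ_two]
    erw [Fin.sum_univ_one]
    rfl
  refine ⟨?_, ?_, ?_, ?_⟩
  · intro r r' h
    rw [hO]
    fin_cases r <;> fin_cases r' <;> simp at h ⊢
  · simp [minor3, Matrix.det_fin_three]
  · refine ⟨!![c, 1, 0, 0; 1, 0, 0, 1 / c; 0, -(1 / c), -1, 0], ?_⟩
    intro i
    have key : ∀ (A : Matrix (Fin 3) (Fin 4) ℝ) (i : ℤ) (m : Fin 4), i % 4 = (m : ℕ) →
        colZ A i = fun r => A r m := by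
      intro A i m h
      funext r
      simp only [colZ]
      rw [dif_pos (by norm_num)]
      congr 1
      apply Fin.ext
      simp [h]
    have h4 : i % 4 = 0 ∨ i % 4 = 1 ∨ i % 4 = 2 ∨ i % 4 = 3 := by omega
    refine ⟨?_, ?_⟩
    · rcases h4 with h | h | h | h
      · rw [key _ i 0 h, key _ i 0 h]; simp [dotProduct, Fin.sum_univ_three]
      · rw [key _ i 1 h, key _ i 1 h]; simp [dotProduct, Fin.sum_univ_three]
      · rw [key _ i 2 h, key _ i 2 h]; simp [dotProduct, Fin.sum_univ_three]
      · rw [key _ i 3 h, key _ i 3 h]; simp [dotProduct, Fin.sum_univ_three, hc']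
    · intro j h1 h2
      have hj : j = i - 1 ∨ j = i - 2 := by push_cast at h1; omega
      rcases h4 with h | h | h | h <;> rcases hj with hj | hj
      · rw [key _ i 0 h, key _ j 3 (by simp; omega)]; simp [dotProduct, Fin.sum_univ_three]
      · rw [key _ i 0 h, key _ j 2 (by simp; omega)]; simp [dotProduct, Fin.sum_univ_three]
      · rw [key _ i 1 h, key _ j 0 (by simp; omega)]; simp [dotProduct, Fin.sum_univ_three]
      · rw [key _ i 1 h, key _ j 3 (by simp; omega)]; simp [dotProduct, Fin.sum_univ_three, hc']
      · rw [key _ i 2 h, key _ j 1 (by simp; omega)]; simp [dotProduct, Fin.sum_univ_three]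
      · rw [key _ i 2 h, key _ j 0 (by simp; omega)]; simp [dotProduct, Fin.sum_univ_three]
      · rw [key _ i 3 h, key _ j 2 (by simp; omega)]; simp [dotProduct, Fin.sum_univ_three]
      · rw [key _ i 3 h, key _ j 1 (by simp; omega)]; simp [dotProduct, Fin.sum_univ_three]
  · intro t3 t4 h3 h4 t ht T hT E hE
    have h3' : t3 ≠ 0 := h3.ne'
    have h4' : t4 ≠ 0 := h4.ne'
    subst ht
    refine ⟨?_, ?_⟩
    · have key : ∀ (A : Matrix (Fin 3) (Fin 4) ℝ) (i : ℤ) (m : Fin 4), i % 4 = (m : ℕ) →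
          colZ A i = fun r => A r m := by
        intro A i m h
        funext r
        simp only [colZ]
        rw [dif_pos (by norm_num)]
        congr 1
        apply Fin.ext
        simp [h]
      have a0 := (hT 4).1
      have a1 := (hT 4).2 3 (by norm_num) (by norm_num)
      have a2 := (hT 4).2 2 (by norm_num) (by norm_num)
      have b0 := (hT 5).1
      have b1 := (hT 5).2 4 (by norm_num) (by norm_num)
      have b2 := (hT 5).2 3 (by norm_num) (by norm_num)
      have c0 := (hT 2).1
      have c1 := (hT 2).2 1 (by norm_num) (by norm_num)
      have c2 := (hT 2).2 0 (by norm_num) (by norm_num)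
      have d0 := (hT 3).1
      have d1 := (hT 3).2 2 (by norm_num) (by norm_num)
      have d2 := (hT 3).2 1 (by norm_num) (by norm_num)
      simp only [key _ 0 0 rfl, key _ 1 1 rfl, key _ 2 2 rfl, key _ 3 3 rfl, key _ 4 0 rfl,
        key _ 5 1 rfl] at a0 a1 a2 b0 b1 b2 c0 c1 c2 d0 d1 d2
      simp [dotProduct, Fin.sum_univ_three] at a0 a1 a2 b0 b1 b2 c0 c1 c2 d0 d1 d2
      have e1 : T 0 0 = c := by simp only [a0, a2] at a1; linarith
      have e2 : T 2 1 = -(1 / c) := by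
        simp only [b0, b1] at b2; field_simp; linarith
      have e3 : T 1 3 = 1 / c := by
        simp only [d1, d2] at d0; field_simp; linarith
      have e4 : T 2 2 = -1 := by linarith
      subst hE
      ext r j
      fin_cases r <;> fin_cases j <;>
        simp [a0, a2, b0, b1, c1, c2, d1, d2, e1, e2, e3, e4] <;> field_simp
    · intro v hv
      have hr : ∀ r : Fin 3, (fun j => E r j) ∈
          Submodule.span ℝ (Set.range fun r : Fin 3 => (fun j => E r j)) :=
        fun r => Submodule.subset_span ⟨r, rfl⟩
      have hvs : v ∈ Submodule.span ℝ (Set.range fun r : Fin 3 => (fun j => E r j)) := by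
        have : v = (c / t4) • (fun j => E 1 j) + (-(c / t4)) • (fun j => E 2 j) := by
          subst hv hE
          ext j
          fin_cases j <;> simp <;> field_simp
        rw [this]
        exact Submodule.add_mem _ (Submodule.smul_mem _ _ (hr 1)) (Submodule.smul_mem _ _ (hr 2))
      refine ⟨?_, ?_, hvs, ?_⟩
      · intro r
        rw [hQ]
        subst hv hE
        fin_cases r <;> simp <;> field_simp <;> ring
      · rw [hQ]
        subst hv
        simp
        field_simp
        ring
      · intro u hu
        have q0 := hu _ (hr 0)
        have q1 := hu _ (hr 1)
        have q2 := hu _ (hr 2)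
        rw [hQ] at q0 q1 q2
        have : u = u 3 • v := by
          subst hv hE
          simp at q0 q1 q2
          field_simp at q0 q1 q2
          have f2 : u 2 = u 3 * (c * t3 / t4) := by field_simp; linarith
          have f0 : u 0 = u 3 * (1 / (t3 * t4)) := by field_simp; linarith
          have f1 : u 1 = u 3 * (c / t4 ^ 2) := by
            rw [f2] at q1; field_simp at q1 ⊢; linarith
          ext j
          fin_cases j
          · simpa using f0
          · simpa using f1
          · simpa using f2
          · simp
        rw [this]
        exact Submodule.smul_mem _ _ hvs
end

section
/- Let a, b, c > 0 and set L_{12} = ab/(a+b+c), L_{13} = ac/(a+b+c), L_{23} = bc/(a+b+c), and L_{123} = L_{12}L_{13} + L_{12}L_{23} + L_{13}L_{23}. Let M be the 4×6 real matrix with rows (0, 1, 0, −1, 0, 1), (1, 0, 0, L_{12}, 0, −L_{12}−L_{13}), (0, 0, −1, −L_{12}−L_{23}, 0, L_{12}), (0, 0, 0, L_{23}, 1, L_{13}). Then: (i) the rows of M are pairwise Ω-orthogonal for the form Ω on ℝ^6 with n = 3, and all 4×4 minors of M are nonzero and of the same sign; (ii) Δ_{1456}(M)/Δ_{3456}(M)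 = L_{23}/L_{13}, Δ_{1256}(M)/Δ_{1456}(M) = L_{12}/L_{23}, and Δ_{1236}(M)/Δ_{1256}(M) = L_{13}/L_{12}; (iii) with t = (L_{23}/L_{13}, L_{12}, L_{13}, 1, 1/L_{23}, 1/L_{12}), the row span of t·τ⃖(M) equals the row span of the 4×6 matrix with rows (L_{123}/L_{13}, L_{12}, 0, 0, 0, −1/L_{13}), (L_{23}/L_{13}, 0, 0, 0, −1/L_{12}, −1/(L_{12}L_{13})), (−1, −1, −L_{13}, 0, 0, 0), (0, 0, L_{12}, 1/L_{23}, 1/L_{23}, 0); (iv) L_{123}/L_{23} = a, L_{123}/L_{13} = b, and L_{123}/L_{12} = c. -/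
open Matrix

/-- The `4×4` minor of a `4 × 6` matrix on columns `i, j, k, l`. -/
def minor4 (M : Matrix (Fin 4) (Fin 6) ℝ) (i j k l : Fin 6) : ℝ :=
  Matrix.det (Matrix.of fun r (s : Fin 4) => M r (![i, j, k, l] s))

theorem colZ_six (M : Matrix (Fin 4) (Fin 6) ℝ) (i : ℤ) (m : Fin 6) (h : i % 6 = (m : ℕ)) :
    colZ M i = fun r => M r m := by
  funext r
  have h6 : (0 : ℕ) < 6 := by norm_num
  unfold colZ
  rw [dif_pos h6]
  congr 1
  apply Fin.ext
  show (i % ((6 : ℕ) : ℤ)).toNat = m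
  have : ((6 : ℕ) : ℤ) = 6 := rfl
  rw [this, h]
  simp

theorem leftTwist_six (M T : Matrix (Fin 4) (Fin 6) ℝ) :
    IsLeftTwist M T ↔ ∀ m : Fin 6,
      (fun r => T r m) ⬝ᵥ (fun r => M r m) = 1 ∧
      (fun r => T r m) ⬝ᵥ (fun r => M r (m - 1)) = 0 ∧
      (fun r => T r m) ⬝ᵥ (fun r => M r (m - 2)) = 0 ∧
      (fun r => T r m) ⬝ᵥ (fun r => M r (m - 3)) = 0 := by
  have key : ∀ (i : ℤ) (m : Fin 6), i % 6 = (m : ℕ) →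
      (i - 1) % 6 = ((m - 1 : Fin 6) : ℕ) ∧ (i - 2) % 6 = ((m - 2 : Fin 6) : ℕ) ∧
      (i - 3) % 6 = ((m - 3 : Fin 6) : ℕ) := by
    intro i m h
    fin_cases m <;> simp at h ⊢ <;> refine ⟨?_, ?_, ?_⟩ <;>
      first | omega | (change _ = (4 : ℤ); omega) | (change _ = (3 : ℤ); omega)
  constructor
  · intro H m
    have hm : ((m : ℕ) : ℤ) % 6 = (m : ℕ) := by omega
    obtain ⟨k1, k2, k3⟩ := key _ m hm
    obtain ⟨h0, hj⟩ := H ((m : ℕ) : ℤ)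
    have e1 := hj (((m : ℕ) : ℤ) - 1) (by push_cast; omega) (by omega)
    have e2 := hj (((m : ℕ) : ℤ) - 2) (by push_cast; omega) (by omega)
    have e3 := hj (((m : ℕ) : ℤ) - 3) (by push_cast; omega) (by omega)
    rw [colZ_six T _ m hm, colZ_six M _ _ hm] at h0
    rw [colZ_six T _ m hm, colZ_six M _ _ k1] at e1
    rw [colZ_six T _ m hm, colZ_six M _ _ k2] at e2
    rw [colZ_six T _ m hm, colZ_six M _ _ k3] at e3
    exact ⟨h0, e1, e2, e3⟩
  · intro H i
    obtain ⟨m, hm⟩ : ∃ m : Fin 6, i % 6 = (m : ℕ) :=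
      ⟨⟨(i % 6).toNat, by omega⟩, by simp; omega⟩
    obtain ⟨k1, k2, k3⟩ := key _ m hm
    obtain ⟨h0, e1, e2, e3⟩ := H m
    refine ⟨by rw [colZ_six T _ m hm, colZ_six M _ _ hm]; exact h0, ?_⟩
    intro j h1 h2
    have h1' : i - 3 ≤ j := by push_cast at h1; omega
    have : j = i - 1 ∨ j = i - 2 ∨ j = i - 3 := by omega
    rcases this with rfl | rfl | rfl
    · rw [colZ_six T _ m hm, colZ_six M _ _ k1]; exact e1
    · rw [colZ_six T _ m hm, colZ_six M _ _ k2]; exact e2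
    · rw [colZ_six T _ m hm, colZ_six M _ _ k3]; exact e3

theorem det_four (A : Matrix (Fin 4) (Fin 4) ℝ) : A.det =
    A 0 0 * (A 1 1 * (A 2 2 * A 3 3 - A 2 3 * A 3 2) - A 1 2 * (A 2 1 * A 3 3 - A 2 3 * A 3 1)
      + A 1 3 * (A 2 1 * A 3 2 - A 2 2 * A 3 1))
    - A 0 1 * (A 1 0 * (A 2 2 * A 3 3 - A 2 3 * A 3 2) - A 1 2 * (A 2 0 * A 3 3 - A 2 3 * A 3 0)
      + A 1 3 * (A 2 0 * A 3 2 - A 2 2 * A 3 0))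
    + A 0 2 * (A 1 0 * (A 2 1 * A 3 3 - A 2 3 * A 3 1) - A 1 1 * (A 2 0 * A 3 3 - A 2 3 * A 3 0)
      + A 1 3 * (A 2 0 * A 3 1 - A 2 1 * A 3 0))
    - A 0 3 * (A 1 0 * (A 2 1 * A 3 2 - A 2 2 * A 3 1) - A 1 1 * (A 2 0 * A 3 2 - A 2 2 * A 3 0)
      + A 1 2 * (A 2 0 * A 3 1 - A 2 1 * A 3 0)) := by
  simp [Matrix.det_succ_row_zero, Fin.sum_univ_succ, Fin.succAbove]
  ring

set_option synthInstance.maxSize 10000 in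
set_option synthInstance.maxHeartbeats 400000 in
theorem quad_cases : ∀ i j k l : Fin 6, i < j → j < k → k < l →
    (i = 0 ∧ j = 1 ∧ k = 2 ∧ l = 3) ∨ (i = 0 ∧ j = 1 ∧ k = 2 ∧ l = 4) ∨
    (i = 0 ∧ j = 1 ∧ k = 2 ∧ l = 5) ∨ (i = 0 ∧ j = 1 ∧ k = 3 ∧ l = 4) ∨
    (i = 0 ∧ j = 1 ∧ k = 3 ∧ l = 5) ∨ (i = 0 ∧ j = 1 ∧ k = 4 ∧ l = 5) ∨
    (i = 0 ∧ j = 2 ∧ k = 3 ∧ l = 4) ∨ (i = 0 ∧ j = 2 ∧ k = 3 ∧ l = 5) ∨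
    (i = 0 ∧ j = 2 ∧ k = 4 ∧ l = 5) ∨ (i = 0 ∧ j = 3 ∧ k = 4 ∧ l = 5) ∨
    (i = 1 ∧ j = 2 ∧ k = 3 ∧ l = 4) ∨ (i = 1 ∧ j = 2 ∧ k = 3 ∧ l = 5) ∨
    (i = 1 ∧ j = 2 ∧ k = 4 ∧ l = 5) ∨ (i = 1 ∧ j = 3 ∧ k = 4 ∧ l = 5) ∨
    (i = 2 ∧ j = 3 ∧ k = 4 ∧ l = 5) := by
  decide +kernel

theorem minors_pos (x y z : ℝ) (hx : 0 < x) (hy : 0 < y) (hz : 0 < z)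
    (f : Fin 4 → Fin 6) (hf : StrictMono f) :
    0 < Matrix.det ((!![0, 1, 0, -1, 0, 1;
                 1, 0, 0, x, 0, -x - y;
                 0, 0, -1, -x - z, 0, x;
                 0, 0, 0, z, 1, y] : Matrix (Fin 4) (Fin 6) ℝ).submatrix id f) := by
  have hxy := mul_pos hx hy
  have hxz := mul_pos hx hz
  have hyz := mul_pos hy hz
  rw [det_four]
  simp only [Matrix.submatrix_apply, id]
  rcases quad_cases (f 0) (f 1) (f 2) (f 3) (hf (by decide)) (hf (by decide)) (hf (by decide)) with
    h | h | h | h | h | h | h | h | h | h | h | h | h | h | h <;>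
  · obtain ⟨h0, h1, h2, h3⟩ := h
    rw [h0, h1, h2, h3]
    simp
    try nlinarith

theorem inverse_map_example (a b c : ℝ) (ha : 0 < a) (hb : 0 < b) (hc : 0 < c)
    (L12 L13 L23 L123 : ℝ)
    (h12 : L12 = a * b / (a + b + c)) (h13 : L13 = a * c / (a + b + c))
    (h23 : L23 = b * c / (a + b + c))
    (h123 : L123 = L12 * L13 + L12 * L23 + L13 * L23)
    (M : Matrix (Fin 4) (Fin 6) ℝ)
    (hM : M = !![0, 1, 0, -1, 0, 1;
                 1, 0, 0, L12, 0, -L12 - L13;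
                 0, 0, -1, -L12 - L23, 0, L12;
                 0, 0, 0, L23, 1, L13]) :
    -- (i) rows pairwise Ω-orthogonal (n = 3), all 4×4 minors nonzero of the same sign:
    (∀ r r' : Fin 4, r ≠ r' → Omega 3 (fun j => M r j) (fun j => M r' j) = 0) ∧
    (∀ f : Fin 4 → Fin 6, StrictMono f → Matrix.det (M.submatrix id f) ≠ 0) ∧
    (∀ f g : Fin 4 → Fin 6, StrictMono f → StrictMono g →
      0 < Matrix.det (M.submatrix id f) * Matrix.det (M.submatrix id g)) ∧
    -- (ii) the ratios of consecutive cyclic minors: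
    (minor4 M 0 3 4 5 / minor4 M 2 3 4 5 = L23 / L13 ∧
      minor4 M 0 1 4 5 / minor4 M 0 3 4 5 = L12 / L23 ∧
      minor4 M 0 1 2 5 / minor4 M 0 1 4 5 = L13 / L12) ∧
    -- (iii) the left twist exists, and the row span of `t·τ⃖(M)` is the stated span:
    (∃ T : Matrix (Fin 4) (Fin 6) ℝ, IsLeftTwist M T) ∧
    (∀ t : Fin 6 → ℝ, t = ![L23 / L13, L12, L13, 1, 1 / L23, 1 / L12] →
      ∀ T : Matrix (Fin 4) (Fin 6) ℝ, IsLeftTwist M T →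
      ∀ E : Matrix (Fin 4) (Fin 6) ℝ,
        E = !![L123 / L13, L12, 0, 0, 0, -(1 / L13);
               L23 / L13, 0, 0, 0, -(1 / L12), -(1 / (L12 * L13));
               -1, -1, -L13, 0, 0, 0;
               0, 0, L12, 1 / L23, 1 / L23, 0] →
        Submodule.span ℝ (Set.range fun r : Fin 4 => (fun j => t j * T r j)) =
          Submodule.span ℝ (Set.range fun r : Fin 4 => (fun j => E r j))) ∧
    -- (iv) recovering the conductances:
    (L123 / L23 = a ∧ L123 / L13 = b ∧ L123 / L12 = c) := by
  have hs : 0 < a + b + c := by positivity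
  have p12 : 0 < L12 := by rw [h12]; positivity
  have p13 : 0 < L13 := by rw [h13]; positivity
  have p23 : 0 < L23 := by rw [h23]; positivity
  have n12 := p12.ne'
  have n13 := p13.ne'
  have n23 := p23.ne'
  have pos : ∀ f : Fin 4 → Fin 6, StrictMono f → 0 < Matrix.det (M.submatrix id f) := by
    intro f hf
    rw [hM]
    exact minors_pos _ _ _ p12 p13 p23 f hf
  refine ⟨?_, fun f hf => (pos f hf).ne', fun f g hf hg => mul_pos (pos f hf) (pos g hg),
    ?_, ?_, ?_, ?_⟩
  · intro r r' _
    subst hM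
    fin_cases r <;> fin_cases r' <;> simp [Omega, Fin.sum_univ_succ] <;> try ring
  · have m1 : minor4 M 0 3 4 5 = L23 := by
      subst hM
      simp [minor4, det_four]
      try ring
    have m2 : minor4 M 2 3 4 5 = L13 := by
      subst hM
      simp [minor4, det_four]
      try ring
    have m3 : minor4 M 0 1 4 5 = L12 := by
      subst hM
      simp [minor4, det_four]
      try ring
    have m4 : minor4 M 0 1 2 5 = L13 := by
      subst hM
      simp [minor4, det_four]
      try ring
    rw [m1, m2, m3, m4]
    exact ⟨rfl, rfl, rfl⟩
  · refine ⟨!![L123 / L23, 1, 0, 0, 0, -(L12 / L13);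
               1, 0, 0, 0, -(L23 / L12), -(1 / L13);
               -(L13 / L23), -(1 / L12), -1, 0, 0, 0;
               0, 0, L12 / L13, 1 / L23, 1, 0], ?_⟩
    rw [leftTwist_six]
    subst hM h123
    intro m
    fin_cases m <;> simp [dotProduct, Fin.sum_univ_succ] <;> (try constructor) <;>
      field_simp <;> try ring
  · intro t ht T hT E hE
    have hTE : (fun r : Fin 4 => (fun j => t j * T r j)) = fun r => (fun j => E r j) := by
      rw [leftTwist_six] at hT
      have q0 := hT 0
      have q1 := hT 1
      have q2 := hT 2
      have q3 := hT 3
      have q4 := hT 4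
      have q5 := hT 5
      subst hM
      simp [dotProduct, Fin.sum_univ_succ] at q0 q1 q2 q3 q4 q5
      obtain ⟨a1, a2, a3, a4⟩ := q0
      obtain ⟨b1, b2, b3, b4⟩ := q1
      obtain ⟨c1, c2, c3, c4⟩ := q2
      obtain ⟨d1, d2, d3, d4⟩ := q3
      obtain ⟨e1, e2, e3, e4⟩ := q4
      obtain ⟨f1, f2, f3, f4⟩ := q5
      have c1' : T 2 2 = -1 := by linarith
      rw [a1, a3] at a2 a4
      rw [b1, b2, b4] at b3
      rw [c2, c3, c1'] at c4
      rw [d2, d3, d4] at d1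
      rw [e1, e3, e4] at e2
      rw [f2, f4] at f1 f3
      have v20 : T 2 0 = -(L13 / L23) := by field_simp; linarith
      have v00 : T 0 0 = L123 / L23 := by
        rw [v20] at a2
        field_simp at a2 ⊢
        linarith
      have v21 : T 2 1 = -(1 / L12) := by field_simp; linarith
      have v32 : T 3 2 = L12 / L13 := by field_simp; linarith
      have v33 : T 3 3 = 1 / L23 := by field_simp; linarith
      have v14 : T 1 4 = -(L23 / L12) := by field_simp; linarith
      have v15 : T 1 5 = -(1 / L13) := by field_simp; linarith
      have v05 : T 0 5 = -(L12 / L13) := by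
        rw [v15] at f3
        field_simp at f3 ⊢
        linarith
      subst ht hE
      funext r j
      fin_cases r <;> fin_cases j <;> simp [*] <;> field_simp
    rw [hTE]
  · subst h123 h12 h13 h23
    refine ⟨?_, ?_, ?_⟩ <;> field_simp
end
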